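/- For every integer d ≥ 2 there exists a constant C_d > 0, depending only on d, with the following property. Let p > d be a prime, let f ∈ ℤ[X] have degree d, let m ≥ 1, and suppose that in K[X] the derivative factors completely as f'(X) = a · ∏_{ξ∈R} (X − ξ)^{e_ξ}, where R ⊆ K is the finite set of distinct roots of f', each e_ξ ≥ 1, and a is the leading coefficient of f'. Then |S_m(f)| ≤ C_d · max_{ξ∈R} ( p^{-m} / |a · ∏_{η∈R, η≠ξ} (ξ − η)^{e_η}| )^{1/(e_ξ+1)}. -/

import Mathlib

open Polynomial

/-- The normalized complete exponential sum `S_m(f) = p^{-m} ∑_{x=0}^{p^m-1} e^{2πi f(x)/p^m}`. -/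
noncomputable def expSum (p m : ℕ) (f : Polynomial ℤ) : ℂ :=
  ((p : ℂ) ^ m)⁻¹ * ∑ x ∈ Finset.range (p ^ m),
    Complex.exp (2 * (Real.pi : ℂ) * Complex.I * ((f.eval (x : ℤ) : ℤ) : ℂ) / (p : ℂ) ^ m)

theorem exists_sum_smul_eq_zero_of_degree_lt {F ι : Type*} [Field F] [Fintype ι] (g : ι → F[X])
    (n : ℕ) (hg : ∀ i, (g i).degree < n) (hn : n < Fintype.card ι) :
    ∃ c : ι → F, c ≠ 0 ∧ ∑ i, c i • g i = 0 := by
  let g' : ι → degreeLT F n := fun i => ⟨g i, mem_degreeLT.2 (hg i)⟩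
  have hfin : Module.finrank F (degreeLT F n) = n := by
    rw [(degreeLTEquiv F n).finrank_eq]; simp
  have : FiniteDimensional F (degreeLT F n) :=
    (degreeLTEquiv F n).symm.finiteDimensional
  have hnot : ¬ LinearIndependent F g' := fun h => by
    have := h.fintype_card_le_finrank
    omega
  obtain ⟨c, hc, i, hi⟩ := Fintype.not_linearIndependent_iff.1 hnot
  refine ⟨c, fun h => hi (by simp [h]), ?_⟩
  simpa [g'] using congrArg (Submodule.subtype _) hc

theorem natDegree_sum_frobenius_iterates {F : Type*} [Field F] (p : ℕ) [hp : Fact p.Prime]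
    (f : F[X]) (hd : 0 < f.natDegree) (k : ℕ) :
    (∑ i ∈ Finset.range (k + 1), f ^ p ^ i).natDegree = f.natDegree * p ^ k := by
  induction k with
  | zero => simp
  | succ k ih =>
    rw [Finset.sum_range_succ, natDegree_add_eq_right_of_natDegree_lt, natDegree_pow, mul_comm]
    rw [ih, natDegree_pow, mul_comm]
    exact Nat.mul_lt_mul_of_pos_right (Nat.pow_lt_pow_right hp.out.one_lt (Nat.lt_succ_self k)) hd

/-- Elements of a field with `q = p ^ (2k+2)` elements on which the trace of `f` takes a given value:
their number exceeds `q / p` by at most `O(√q)`. -/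
theorem card_trace_eq_le {F : Type*} [Field F] [IsAlgClosed F] (p : ℕ) [hp : Fact p.Prime]
    [CharP F p] (f : F[X]) (hd : 0 < f.natDegree) (hpd : ¬ p ∣ f.natDegree) (k : ℕ) (t : F)
    (Z : Finset F) (hZ : ∀ α ∈ Z, α ^ p ^ (2 * (k + 1)) = α ∧
      ∑ i ∈ Finset.range (2 * (k + 1)), (f.eval α) ^ p ^ i = t) :
    Z.card ≤ p ^ (2 * k + 1) + 2 * f.natDegree * p ^ (k + 1) := by
  classical
  set d := f.natDegree with hdd
  set P := p ^ k with hP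
  set Q := p ^ (k + 1) with hQ
  have hQP : Q = p * P := by rw [hQ, hP, pow_succ, mul_comm]
  have hp2 : 2 ≤ p := hp.out.two_le
  have hP0 : 0 < P := by positivity
  set S : F[X] := ∑ i ∈ Finset.range (k + 1), f ^ p ^ i with hS
  have hSdeg : S.natDegree = d * P := natDegree_sum_frobenius_iterates p f hd k
  have hS0 : S ≠ 0 := by
    intro h; rw [h] at hSdeg; simp at hSdeg; omega
  let ι := Fin P × Fin (P + d) × Fin p
  let g : ι → F[X] := fun x => X ^ (x.1.1 * Q + x.2.1.1) * (C t - S) ^ x.2.2.1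
  have hcard : Fintype.card ι = Q * (P + d) := by
    simp only [ι, Fintype.card_prod, Fintype.card_fin, hQP]; ring
  have hbound : ∀ i, (g i).degree < ((Q * (P + d) - 1 : ℕ) : WithBot ℕ) := by
    rintro ⟨⟨a, ha⟩, ⟨i, hi⟩, ⟨j, hj⟩⟩
    refine lt_of_le_of_lt degree_le_natDegree (Nat.cast_lt.2 ?_)
    have h1 : (C t - S).natDegree ≤ d * P := by
      refine (natDegree_sub_le _ _).trans ?_
      simp [hSdeg]
    have h2 : (g (⟨a, ha⟩, ⟨i, hi⟩, ⟨j, hj⟩)).natDegree ≤ a * Q + i + j * (d * P) := by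
      refine natDegree_mul_le.trans ?_
      rw [natDegree_X_pow]
      exact Nat.add_le_add_left (natDegree_pow_le.trans (Nat.mul_le_mul_left _ h1)) _
    refine lt_of_le_of_lt h2 ?_
    have h3 : Q * (a + 1) ≤ Q * P := Nat.mul_le_mul_left _ ha
    have h4 : (j + 1) * (d * P) ≤ p * (d * P) := Nat.mul_le_mul_right _ hj
    have h5 : p * (d * P) = Q * d := by rw [hQP]; ring
    have h6 : d ≤ d * P := Nat.le_mul_of_pos_right _ hP0
    have h7 : 2 * P ≤ Q := by rw [hQP]; exact Nat.mul_le_mul_right _ hp2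
    have h8 : Q * (a + 1) = a * Q + Q := by ring
    have h9 : (j + 1) * (d * P) = j * (d * P) + d * P := by ring
    have h10 : Q * (P + d) = Q * P + Q * d := by ring
    omega
  have hpos : 0 < Q * (P + d) := by positivity
  obtain ⟨c, hc0, hc⟩ := exists_sum_smul_eq_zero_of_degree_lt g _ hbound (by rw [hcard]; omega)
  have hroot : ∀ x, ∃ b : F, b ^ Q = c x := fun x =>
    IsAlgClosed.exists_pow_nat_eq (c x) (by positivity)
  choose b hb using hroot
  let G' : ι → F[X] := fun x => C (b x) * (X ^ (x.1.1 + Q * x.2.1.1) * S ^ x.2.2.1)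
  have hG'deg : ∀ x, b x ≠ 0 → (G' x).degree =
      ((x.1.1 + Q * x.2.1.1 + x.2.2.1 * (d * P) : ℕ) : WithBot ℕ) := by
    intro x hx
    rw [degree_C_mul hx, degree_mul, degree_X_pow, degree_pow, degree_eq_natDegree hS0, hSdeg]
    push_cast
    simp
  have hcop : Nat.Coprime p d := (Nat.Prime.coprime_iff_not_dvd hp.out).2 hpd
  have hdisj : Set.Pairwise {x | x ∈ Finset.univ ∧ G' x ≠ 0}
      (fun x y => (G' x).degree ≠ (G' y).degree) := by
    rintro ⟨⟨a, ha⟩, ⟨i, hi⟩, ⟨j, hj⟩⟩ hx ⟨⟨a', ha'⟩, ⟨i', hi'⟩, ⟨j', hj'⟩⟩ hy hne heq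
    apply hne
    rw [hG'deg _ (fun h => hx.2 (by simp [G', h])), hG'deg _ (fun h => hy.2 (by simp [G', h]))]
      at heq
    have heq := Nat.cast_injective heq
    dsimp only at heq
    have e1 : a + P * (p * i + j * d) = a' + P * (p * i' + j' * d) := by
      calc _ = a + Q * i + j * (d * P) := by rw [hQP]; ring
        _ = _ := heq
        _ = _ := by rw [hQP]; ring
    have e2 : a = a' := by
      have := congrArg (· % P) e1
      simpa [Nat.add_mul_mod_self_left, Nat.mod_eq_of_lt ha, Nat.mod_eq_of_lt ha'] using this
    subst e2
    have e3 : p * i + j * d = p * i' + j' * d :=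
      Nat.eq_of_mul_eq_mul_left hP0 (Nat.add_left_cancel e1)
    have e4 : j = j' := by
      have h : j * d ≡ j' * d [MOD p] := by
        have := congrArg (· % p) e3
        simpa [Nat.ModEq, Nat.mul_add_mod] using this
      have := Nat.ModEq.cancel_right_of_coprime (by simpa using hcop) h
      exact Nat.ModEq.eq_of_lt_of_lt this hj hj'
    subst e4
    have e5 : i = i' := Nat.eq_of_mul_eq_mul_left hp.out.pos (Nat.add_right_cancel e3)
    subst e5
    rfl
  set G : F[X] := ∑ x, G' x with hG
  have hGdeg := degree_sum_eq_of_disjoint G' Finset.univ hdisj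
  have hG0 : G ≠ 0 := by
    obtain ⟨x, hx⟩ := Function.ne_iff.1 hc0
    have hbx : b x ≠ 0 := by
      intro h
      apply hx
      rw [← hb x, h, zero_pow (by positivity)]
      rfl
    intro h
    rw [← hG, h, degree_zero] at hGdeg
    have := (Finset.le_sup (f := fun i => degree (G' i)) (Finset.mem_univ x))
    rw [← hGdeg, hG'deg x hbx] at this
    exact WithBot.coe_ne_bot (le_bot_iff.1 this)
  have hGnat : G.natDegree ≤ p ^ (2 * k + 1) + 2 * d * p ^ (k + 1) := by
    refine natDegree_sum_le_of_forall_le _ _ ?_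
    rintro ⟨⟨a, ha⟩, ⟨i, hi⟩, ⟨j, hj⟩⟩ -
    by_cases hbx : b (⟨a, ha⟩, ⟨i, hi⟩, ⟨j, hj⟩) = 0
    · simp [G', hbx]
    rw [natDegree_eq_of_degree_eq_some (hG'deg _ hbx)]
    dsimp only
    have h1 : p ^ (2 * k + 1) = Q * P := by rw [hQ, hP]; ring
    rw [h1, ← hQ]
    have h2 : Q * (i + 1) ≤ Q * (P + d) := Nat.mul_le_mul_left _ (by omega)
    have h3 : j * (d * P) ≤ p * (d * P) := Nat.mul_le_mul_right _ hj.le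
    have h5 : p * (d * P) = Q * d := by rw [hQP]; ring
    have h6 : 2 * P ≤ Q := by rw [hQP]; exact Nat.mul_le_mul_right _ hp2
    nlinarith
  have hGroot : ∀ α ∈ Z, G.IsRoot α := by
    intro α hα
    obtain ⟨h1, h2⟩ := hZ α hα
    have hQQ : p ^ (2 * (k + 1)) = Q * Q := by rw [hQ]; ring
    rw [hQQ] at h1
    have hSα : (S.eval α) ^ Q = t - S.eval α := by
      rw [← h2, two_mul, Finset.sum_range_add, hS, eval_finsetSum, hQ, sum_pow_char_pow]
      simp only [eval_pow, add_sub_cancel_left, ← pow_mul, ← pow_add]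
      simp only [add_comm]
    have hpow : (G.eval α) ^ Q = 0 := by
      have h3 := congrArg (eval α) hc
      rw [eval_finsetSum, eval_zero] at h3
      rw [← h3, hG, eval_finsetSum, hQ, sum_pow_char_pow, ← hQ]
      refine Finset.sum_congr rfl fun x _ => ?_
      simp only [G', g, eval_mul, eval_C, eval_pow, eval_X, eval_smul, eval_sub, smul_eq_mul,
        mul_pow]
      have h4 : (α ^ (x.1.1 + Q * x.2.1.1)) ^ Q = α ^ (x.1.1 * Q + x.2.1.1) := by
        rw [← pow_mul, show (x.1.1 + Q * x.2.1.1) * Q = x.1.1 * Q + Q * Q * x.2.1.1 by ring,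
          pow_add, pow_mul α (Q * Q), h1, ← pow_add]
      rw [hb, ← hSα, h4, pow_right_comm]
    exact pow_eq_zero_iff (by positivity) |>.1 hpow
  calc Z.card ≤ G.roots.toFinset.card :=
        Finset.card_le_card fun α hα => by simpa using ⟨hG0, hGroot α hα⟩
    _ ≤ Multiset.card G.roots := Multiset.toFinset_card_le _
    _ ≤ G.natDegree := card_roots' _
    _ ≤ _ := hGnat

/-- The multiset `{α, σ α, …, σ^(r-1) α}`. -/
def iterateMultiset {X : Type*} (σ : X → X) (r : ℕ) (α : X) : Multiset X :=
  (Multiset.range r).map fun i => σ^[i] α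

theorem card_iterateMultiset {X : Type*} (σ : X → X) (r : ℕ) (α : X) :
    Multiset.card (iterateMultiset σ r α) = r := by
  simp [iterateMultiset]

theorem self_mem_iterateMultiset {X : Type*} (σ : X → X) {r : ℕ} (hr : 1 ≤ r) (α : X) :
    α ∈ iterateMultiset σ r α :=
  Multiset.mem_map.2 ⟨0, Multiset.mem_range.2 hr, rfl⟩

theorem map_iterateMultiset {X : Type*} (σ : X → X) {r : ℕ} {α : X} (h : σ^[r] α = α) :
    (iterateMultiset σ r α).map σ = iterateMultiset σ r α := by
  have h1 := congrArg (Multiset.map fun i => σ^[i] α) (Multiset.range_succ r)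
  have h2 : Multiset.map (fun i => σ^[i] α) (Multiset.range (r + 1)) =
      α ::ₘ (iterateMultiset σ r α).map σ := by
    rw [add_comm, Multiset.range_add]
    simp [iterateMultiset, add_comm 1, Function.iterate_succ_apply']
  rw [h2, Multiset.map_cons, h] at h1
  exact (Multiset.cons_inj_right _).1 h1

theorem iterateMultiset_mul {X : Type*} (σ : X → X) {r : ℕ} {α : X} (h : σ^[r] α = α) (k : ℕ) :
    iterateMultiset σ (r * k) α = k • iterateMultiset σ r α := by
  induction k with
  | zero => simp [iterateMultiset]
  | succ k ih =>
    rw [succ_nsmul, ← ih, Nat.mul_succ]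
    simp only [iterateMultiset, Multiset.range_add, Multiset.map_add, Multiset.map_map,
      Function.comp_def]
    congr 1
    refine Multiset.map_congr rfl fun i _ => ?_
    rw [add_comm, Function.iterate_add_apply, Function.iterate_mul,
      Function.iterate_fixed h]

theorem count_iterate_of_map_eq {X : Type*} [DecidableEq X] {σ : X → X}
    (hσ : Function.Injective σ) {G : Multiset X} (hG : G.map σ = G) (α : X) (i : ℕ) :
    G.count (σ^[i] α) = G.count α := by
  induction i with
  | zero => rfl
  | succ i ih =>
    rw [Function.iterate_succ_apply', ← ih]
    conv_lhs => rw [← hG]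
    exact Multiset.count_map_eq_count' _ _ hσ _

theorem card_periods_eq_count {X : Type*} [DecidableEq X] {σ : X → X}
    (hσ : Function.Injective σ) {G : Multiset X} (hG : G.map σ = G) {α : X} (hα : α ∈ G) :
    ((Finset.Icc 1 (Multiset.card G)).filter
      fun r => σ^[r] α = α ∧ iterateMultiset σ r α ≤ G).card = G.count α := by
  have hper : 0 < Function.minimalPeriod σ α := by
    have hmem : ∀ i, σ^[i] α ∈ G.toFinset := fun i => by
      rw [Multiset.mem_toFinset, ← Multiset.count_pos, count_iterate_of_map_eq hσ hG,
        Multiset.count_pos]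
      exact hα
    obtain ⟨i, -, j, -, hij, h⟩ := Set.infinite_univ.exists_ne_map_eq_of_mapsTo
      (f := fun i : ℕ => σ^[i] α) (fun i _ => hmem i) (Finset.finite_toSet G.toFinset)
    wlog hlt : i < j generalizing i j
    · exact this j i hij.symm h.symm (by omega)
    have : σ^[j - i] α = α := by
      apply hσ.iterate i
      rw [← Function.iterate_add_apply, Nat.add_sub_cancel' hlt.le]
      exact h.symm
    exact Function.IsPeriodicPt.minimalPeriod_pos (by omega) this
  set δ := Function.minimalPeriod σ α with hδ
  have hδper : σ^[δ] α = α := Function.iterate_minimalPeriod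
  have hnodup : (iterateMultiset σ δ α).Nodup := by
    refine Multiset.Nodup.map_on ?_ (Multiset.nodup_range _)
    intro i hi j hj h
    exact Function.iterate_injOn_Iio_minimalPeriod (by simpa using hi) (by simpa using hj) h
  have hcount : ∀ k, (iterateMultiset σ (δ * k) α).count α = k := fun k => by
    rw [iterateMultiset_mul σ hδper, Multiset.count_nsmul,
      Multiset.count_eq_one_of_mem hnodup (self_mem_iterateMultiset σ hper α), mul_one]
  have himage : (Finset.Icc 1 (Multiset.card G)).filter
      (fun r => σ^[r] α = α ∧ iterateMultiset σ r α ≤ G) =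
        (Finset.Icc 1 (G.count α)).image (δ * ·) := by
    ext r
    simp only [Finset.mem_filter, Finset.mem_Icc, Finset.mem_image]
    constructor
    · rintro ⟨⟨h1, -⟩, h2, h3⟩
      obtain ⟨k, rfl⟩ := Function.IsPeriodicPt.minimalPeriod_dvd h2
      refine ⟨k, ⟨Nat.pos_of_mul_pos_left h1, ?_⟩, rfl⟩
      rw [← hcount k]
      exact Multiset.count_le_of_le _ h3
    · rintro ⟨k, ⟨h1, h2⟩, rfl⟩
      have hle : iterateMultiset σ (δ * k) α ≤ G := by
        rw [Multiset.le_iff_count]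
        intro β
        by_cases hβ : β ∈ iterateMultiset σ (δ * k) α
        · obtain ⟨i, -, rfl⟩ := Multiset.mem_map.1 hβ
          rw [count_iterate_of_map_eq hσ hG, iterateMultiset_mul σ hδper, Multiset.count_nsmul]
          have := Multiset.nodup_iff_count_le_one.1 hnodup (σ^[i] α)
          nlinarith
        · rw [Multiset.count_eq_zero_of_notMem hβ]
          exact Nat.zero_le _
      refine ⟨⟨Nat.mul_pos hper h1, ?_⟩, ?_, hle⟩
      · simpa [card_iterateMultiset] using Multiset.card_le_card hle
      · rw [Function.iterate_mul, Function.iterate_fixed hδper]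
  rw [himage, Finset.card_image_of_injective _ fun a b h => Nat.eq_of_mul_eq_mul_left hper h,
    Nat.card_Icc, Nat.add_sub_cancel]

/-- The logarithmic derivative of the zeta function of the dynamical system `σ`
with multiplicative weight `w`. -/
theorem card_mul_sum_invariant_multisets {X : Type*} {σ : X → X} (hσ : Function.Injective σ)
    (Y : ℕ → Finset X) (hY : ∀ r, 1 ≤ r → ∀ α, α ∈ Y r ↔ σ^[r] α = α)
    (V : ℕ → Finset (Multiset X))
    (hV : ∀ s G, G ∈ V s ↔ Multiset.card G = s ∧ G.map σ = G) (w : X → ℂ) (s : ℕ) :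
    (s : ℂ) * ∑ G ∈ V s, (G.map w).prod =
      ∑ r ∈ Finset.Icc 1 s, (∑ α ∈ Y r, ∏ i ∈ Finset.range r, w (σ^[i] α)) *
        ∑ H ∈ V (s - r), (H.map w).prod := by
  classical
  have hcard : ∀ G ∈ V s, ∑ r ∈ Finset.Icc 1 s,
      ((Y r).filter fun α => iterateMultiset σ r α ≤ G).card = s := by
    intro G hG
    obtain ⟨h1, h2⟩ := (hV s G).1 hG
    calc ∑ r ∈ Finset.Icc 1 s, ((Y r).filter fun α => iterateMultiset σ r α ≤ G).card
        = ∑ r ∈ Finset.Icc 1 s, (G.toFinset.filter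
            fun α => σ^[r] α = α ∧ iterateMultiset σ r α ≤ G).card := by
          refine Finset.sum_congr rfl fun r hr => congrArg _ ?_
          have hr1 := (Finset.mem_Icc.1 hr).1
          ext α
          simp only [Finset.mem_filter, hY r hr1, Multiset.mem_toFinset]
          constructor
          · rintro ⟨h3, h4⟩
            exact ⟨Multiset.mem_of_le h4 (self_mem_iterateMultiset σ hr1 α), h3, h4⟩
          · rintro ⟨-, h3, h4⟩
            exact ⟨h3, h4⟩
      _ = ∑ α ∈ G.toFinset, ((Finset.Icc 1 s).filter
            fun r => σ^[r] α = α ∧ iterateMultiset σ r α ≤ G).card := by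
          simp only [Finset.card_filter]
          exact Finset.sum_comm
      _ = ∑ α ∈ G.toFinset, G.count α := by
          refine Finset.sum_congr rfl fun α hα => ?_
          rw [← h1]
          exact card_periods_eq_count hσ h2 (Multiset.mem_toFinset.1 hα)
      _ = s := by rw [Multiset.toFinset_sum_count_eq, h1]
  have hinner : ∀ r ∈ Finset.Icc 1 s, ∀ α ∈ Y r,
      ∑ G ∈ (V s).filter (fun G => iterateMultiset σ r α ≤ G), (G.map w).prod =
        (∏ i ∈ Finset.range r, w (σ^[i] α)) * ∑ H ∈ V (s - r), (H.map w).prod := by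
    intro r hr α hα
    obtain ⟨hr1, hrs⟩ := Finset.mem_Icc.1 hr
    have hper := (hY r hr1 α).1 hα
    have hmap := map_iterateMultiset σ hper
    rw [Finset.mul_sum]
    refine Finset.sum_bij' (fun G _ => G - iterateMultiset σ r α)
      (fun H _ => H + iterateMultiset σ r α) ?_ ?_ ?_ ?_ ?_
    · intro G hG
      obtain ⟨h1, h2⟩ := Finset.mem_filter.1 hG
      obtain ⟨h3, h4⟩ := (hV s G).1 h1
      refine (hV _ _).2 ⟨?_, ?_⟩
      · rw [Multiset.card_sub h2, h3, card_iterateMultiset]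
      · have h5 := congrArg (Multiset.map σ) (Multiset.sub_add_cancel h2)
        rw [Multiset.map_add, hmap, h4] at h5
        exact eq_tsub_of_add_eq h5
    · intro H hH
      obtain ⟨h3, h4⟩ := (hV _ H).1 hH
      refine Finset.mem_filter.2 ⟨(hV _ _).2 ⟨?_, ?_⟩, Multiset.le_add_left _ _⟩
      · rw [Multiset.card_add, h3, card_iterateMultiset, Nat.sub_add_cancel hrs]
      · rw [Multiset.map_add, hmap, h4]
    · intro G hG
      exact Multiset.sub_add_cancel (Finset.mem_filter.1 hG).2
    · intro H hH
      exact Multiset.add_sub_cancel_right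
    · intro G hG
      have h5 := congrArg (fun M => (Multiset.map w M).prod)
        (Multiset.sub_add_cancel (Finset.mem_filter.1 hG).2)
      simp only [Multiset.map_add, Multiset.prod_add] at h5
      rw [← h5, mul_comm]
      congr 1
      simp [iterateMultiset, Finset.prod]
  calc (s : ℂ) * ∑ G ∈ V s, (G.map w).prod
      = ∑ G ∈ V s, ∑ r ∈ Finset.Icc 1 s, ∑ α ∈ Y r,
          if iterateMultiset σ r α ≤ G then (G.map w).prod else 0 := by
        rw [Finset.mul_sum]
        refine Finset.sum_congr rfl fun G hG => ?_
        conv_lhs => rw [← hcard G hG]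
        push_cast
        rw [Finset.sum_mul]
        refine Finset.sum_congr rfl fun r _ => ?_
        rw [← Finset.sum_filter, Finset.sum_const, nsmul_eq_mul]
    _ = ∑ r ∈ Finset.Icc 1 s, ∑ α ∈ Y r, ∑ G ∈ V s,
          if iterateMultiset σ r α ≤ G then (G.map w).prod else 0 := by
        rw [Finset.sum_comm]
        exact Finset.sum_congr rfl fun r _ => Finset.sum_comm
    _ = _ := by
        refine Finset.sum_congr rfl fun r hr => ?_
        rw [Finset.sum_mul]
        refine Finset.sum_congr rfl fun α hα => ?_
        rw [← Finset.sum_filter, hinner r hr α hα]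

theorem X_mul_derivative_prod_one_sub (ω : Multiset ℂ) :
    PowerSeries.X * PowerSeries.derivative ℂ
        (ω.map fun z => 1 - PowerSeries.C z * PowerSeries.X).prod =
      (ω.map fun z => 1 - PowerSeries.C z * PowerSeries.X).prod *
        PowerSeries.mk fun r => if r = 0 then 0 else -(ω.map (· ^ r)).sum := by
  induction ω using Multiset.induction_on with
  | empty =>
    have : (PowerSeries.mk fun r => if r = 0 then (0 : ℂ) else
        -((0 : Multiset ℂ).map (· ^ r)).sum) = 0 := by
      ext r; simp
    rw [this]; simp
  | cons z ω ih =>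
    have h1 : (1 - PowerSeries.C z * PowerSeries.X) *
        PowerSeries.mk (fun r => if r = 0 then (0 : ℂ) else -z ^ r) =
          -(PowerSeries.C z * PowerSeries.X) := by
      ext r
      rcases r with _ | r
      · simp
      · rw [sub_mul, mul_assoc]
        rcases r with _ | r
        · simp [mul_comm PowerSeries.X, PowerSeries.coeff_succ_mul_X]
        · simp [mul_comm PowerSeries.X, PowerSeries.coeff_succ_mul_X]
          ring
    have h2 : (PowerSeries.mk fun r => if r = 0 then (0 : ℂ) else
        -((z ::ₘ ω).map (· ^ r)).sum) =
        PowerSeries.mk (fun r => if r = 0 then (0 : ℂ) else -z ^ r) +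
        PowerSeries.mk fun r => if r = 0 then 0 else -(ω.map (· ^ r)).sum := by
      ext r
      by_cases h : r = 0 <;> simp [h, add_comm]
    rw [h2, Multiset.map_cons, Multiset.prod_cons, Derivation.leibniz]
    simp only [smul_eq_mul, mul_add]
    rw [mul_left_comm, ih]
    have h3 : PowerSeries.derivative ℂ (1 - PowerSeries.C z * PowerSeries.X) =
        -PowerSeries.C z := by
      ext r
      rw [PowerSeries.coeff_derivative]
      rcases r with _ | r <;> simp [PowerSeries.coeff_one, PowerSeries.coeff_C]
    rw [h3]
    linear_combination (-(ω.map fun z => 1 - PowerSeries.C z * PowerSeries.X).prod) * h1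

theorem Polynomial.eq_prod_one_sub_of_coeff_zero (L : ℂ[X]) (h : L.coeff 0 = 1) :
    ∃ ω : Multiset ℂ, Multiset.card ω = L.natDegree ∧
      L = (ω.map fun z => 1 - C z * X).prod := by
  have hs : L.Splits := IsAlgClosed.splits L
  have hz : ∀ z ∈ L.roots, z ≠ 0 := by
    rintro z hz rfl
    have := (mem_roots'.1 hz).2
    rw [IsRoot, ← coeff_zero_eq_eval_zero, h] at this
    exact one_ne_zero this
  refine ⟨L.roots.map (·⁻¹), by simpa using hs.natDegree_eq_card_roots.symm, ?_⟩
  have h1 : L = C L.leadingCoeff * (L.roots.map (X - C ·)).prod := hs.eq_prod_roots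
  have h2 : (L.roots.map (X - C ·)).prod =
      C (L.roots.map (-·)).prod * ((L.roots.map (·⁻¹)).map fun z => 1 - C z * X).prod := by
    rw [map_multiset_prod, Multiset.map_map, Multiset.map_map, ← Multiset.prod_map_mul]
    refine congrArg _ (Multiset.map_congr rfl fun z hz' => ?_)
    have : C z * C z⁻¹ = (1 : ℂ[X]) := by rw [← C_mul, mul_inv_cancel₀ (hz z hz'), C_1]
    simp only [Function.comp_apply, map_neg]
    linear_combination (-X) * this
  have h3 : L.leadingCoeff * (L.roots.map (-·)).prod = 1 := by
    rw [← h, coeff_zero_eq_eval_zero]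
    conv_rhs => rw [h1]
    rw [eval_mul, eval_C, eval_multiset_prod, Multiset.map_map]
    simp
  conv_lhs => rw [h1, h2, ← mul_assoc, ← C_mul, h3, C_1, one_mul]

theorem exists_power_sums_of_recurrence (N S : ℕ → ℂ) (d : ℕ) (hd : 1 ≤ d) (hN0 : N 0 = 1)
    (hN : ∀ s, d ≤ s → N s = 0)
    (hrec : ∀ s : ℕ, (s : ℂ) * N s = ∑ r ∈ Finset.Icc 1 s, S r * N (s - r)) :
    ∃ ω : Multiset ℂ, Multiset.card ω < d ∧ ∀ r, 1 ≤ r → S r = -(ω.map (· ^ r)).sum := by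
  let L : ℂ[X] := ∑ s ∈ Finset.range d, monomial s (N s)
  have hL : ∀ s, L.coeff s = N s := by
    intro s
    simp only [L, finsetSum_coeff, coeff_monomial, Finset.sum_ite_eq', Finset.mem_range]
    split_ifs with h
    · rfl
    · exact (hN s (by omega)).symm
  obtain ⟨ω, hω, hprod⟩ := L.eq_prod_one_sub_of_coeff_zero (by rw [hL, hN0])
  refine ⟨ω, ?_, ?_⟩
  · rw [hω]
    refine lt_of_le_of_lt (natDegree_sum_le_of_forall_le (n := d - 1) _ _ fun i hi => ?_) (by omega)
    exact (natDegree_monomial_le _).trans (by have := Finset.mem_range.1 hi; omega)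
  have hcoe : (L : PowerSeries ℂ) = (ω.map fun z => 1 - PowerSeries.C z * PowerSeries.X).prod := by
    rw [hprod, ← Polynomial.coeToPowerSeries.ringHom_apply, map_multiset_prod, Multiset.map_map]
    refine congrArg _ (Multiset.map_congr rfl fun z _ => ?_)
    simp
  have h0 : (L : PowerSeries ℂ) ≠ 0 := by
    intro h
    have := congrArg (PowerSeries.coeff 0) h
    rw [coeff_coe, hL, hN0] at this
    simp at this
  have h1 := X_mul_derivative_prod_one_sub ω
  rw [← hcoe] at h1
  have h2 : PowerSeries.X * PowerSeries.derivative ℂ (L : PowerSeries ℂ) =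
      (L : PowerSeries ℂ) * PowerSeries.mk fun r => if r = 0 then 0 else S r := by
    ext s
    have hl : PowerSeries.coeff s (PowerSeries.X * PowerSeries.derivative ℂ (L : PowerSeries ℂ))
        = s * N s := by
      rcases s with _ | s
      · simp
      · rw [PowerSeries.coeff_succ_X_mul, PowerSeries.coeff_derivative, coeff_coe, hL]
        push_cast; ring
    rw [hl, hrec, mul_comm (L : PowerSeries ℂ), PowerSeries.coeff_mul,
      Finset.Nat.sum_antidiagonal_eq_sum_range_succ_mk, Finset.sum_range_succ',
      Finset.range_eq_Ico, Finset.sum_Ico_add' (fun r => PowerSeries.coeff r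
        (PowerSeries.mk fun r => if r = 0 then 0 else S r) *
          PowerSeries.coeff (s - r) (L : PowerSeries ℂ)) 0 s 1]
    simp only [PowerSeries.coeff_mk, coeff_coe, hL, if_true, zero_mul, add_zero, zero_add]
    refine Finset.sum_congr (by ext; simp) fun r hr => ?_
    rw [if_neg (by have := (Finset.mem_Ico.1 hr).1; omega)]
  have h3 := mul_left_cancel₀ h0 (h2.symm.trans h1)
  intro r hr
  have := congrArg (PowerSeries.coeff r) h3
  simpa [show r ≠ 0 by omega] using this

theorem norm_le_of_norm_power_sum_le (ω : Multiset ℂ) (A B : ℝ) (hB : 0 < B)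
    (h : ∀ n, 1 ≤ n → ‖(ω.map (· ^ n)).sum‖ ≤ A * B ^ n) : ∀ z ∈ ω, ‖z‖ ≤ B := by
  classical
  intro z hz
  by_contra! hlt
  let P : ℂ[X] := ∏ u ∈ ω.toFinset.erase z, (X - C u)
  have hPz : P.eval z ≠ 0 := by
    rw [eval_prod, Finset.prod_ne_zero_iff]
    intro u hu
    simpa [sub_eq_zero] using (Finset.ne_of_mem_erase hu).symm
  have hPu : ∀ u ∈ ω.toFinset, u ≠ z → P.eval u = 0 := fun u hu hne => by
    rw [eval_prod]
    exact Finset.prod_eq_zero (Finset.mem_erase.2 ⟨hne, hu⟩) (by simp)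
  have hsum : ∀ n, ∑ k ∈ Finset.range (P.natDegree + 1), P.coeff k * (ω.map (· ^ (n + k))).sum =
      ω.count z * (z ^ n * P.eval z) := by
    intro n
    calc _ = (ω.map fun u => u ^ n * P.eval u).sum := by
          simp only [eval_eq_sum_range, Finset.mul_sum]
          simp only [← Multiset.sum_map_mul_left]
          rw [Multiset.sum_map_sum]
          refine Finset.sum_congr rfl fun k _ => congrArg _ (Multiset.map_congr rfl fun u _ => ?_)
          ring
      _ = ∑ u ∈ ω.toFinset, ω.count u * (u ^ n * P.eval u) := by
          rw [Finset.sum_multiset_map_count]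
          simp
      _ = _ := by
          rw [Finset.sum_eq_single z]
          · intro u hu hne
            simp [hPu u hu hne]
          · intro h
            exact absurd (Multiset.mem_toFinset.2 hz) h
  set A' := ∑ k ∈ Finset.range (P.natDegree + 1), ‖P.coeff k‖ * (A * B ^ k) with hA'
  have hle : ∀ n, 1 ≤ n → ‖z‖ ^ n * ‖P.eval z‖ ≤ A' * B ^ n := by
    intro n hn
    have hc : (1 : ℝ) ≤ ω.count z := by exact_mod_cast Multiset.count_pos.2 hz
    calc ‖z‖ ^ n * ‖P.eval z‖ ≤ ω.count z * (‖z‖ ^ n * ‖P.eval z‖) :=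
          le_mul_of_one_le_left (by positivity) hc
      _ = ‖(ω.count z * (z ^ n * P.eval z) : ℂ)‖ := by simp
      _ ≤ ∑ k ∈ Finset.range (P.natDegree + 1), ‖P.coeff k * (ω.map (· ^ (n + k))).sum‖ := by
          rw [← hsum]; exact norm_sum_le _ _
      _ ≤ ∑ k ∈ Finset.range (P.natDegree + 1), ‖P.coeff k‖ * (A * B ^ (n + k)) := by
          refine Finset.sum_le_sum fun k _ => ?_
          rw [norm_mul]
          exact mul_le_mul_of_nonneg_left (h _ (by omega)) (norm_nonneg _)
      _ = A' * B ^ n := by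
          rw [hA', Finset.sum_mul]
          refine Finset.sum_congr rfl fun k _ => ?_
          ring
  have hPpos : 0 < ‖P.eval z‖ := norm_pos_iff.2 hPz
  obtain ⟨n, hn⟩ := pow_unbounded_of_one_lt (max (A' / ‖P.eval z‖) 1)
    ((one_lt_div hB).2 hlt)
  have hn1 : 1 ≤ n := by
    rcases n with _ | n
    · have := (le_max_right _ _).trans_lt hn
      simp at this
    · omega
  have h1 := (le_max_left _ _).trans_lt hn
  rw [div_pow, div_lt_div_iff₀ hPpos (by positivity)] at h1
  linarith [hle n hn1]

theorem Multiset.psum_eq_mul_esymm_sub_sum {F : Type*} [CommRing F] (G : Multiset F) (k : ℕ)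
    (h : 0 < k) :
    (G.map (· ^ k)).sum = (-1) ^ (k + 1) * k * G.esymm k -
      ∑ a ∈ Finset.HasAntidiagonal.antidiagonal k with a.1 ∈ Set.Ioo 0 k,
        (-1) ^ a.1 * G.esymm a.1 * (G.map (· ^ a.2)).sum := by
  obtain ⟨n, x, rfl⟩ : ∃ (n : ℕ) (x : Fin n → F), G = Finset.univ.val.map x := by
    induction G using Quotient.inductionOn with
    | _ l => exact ⟨l.length, l.get, by rw [Fin.univ_val_map, List.ofFn_get]; rfl⟩
  have := congrArg (MvPolynomial.aeval x) (MvPolynomial.psum_eq_mul_esymm_sub_sum (Fin n) F k h)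
  have hp : ∀ k, ((Finset.univ.val.map x).map (· ^ k)).sum = ∑ i, x i ^ k := fun k => by
    rw [Multiset.map_map]
    rfl
  simp only [map_sub, map_mul, map_pow, map_neg, map_one, map_natCast, map_sum,
    MvPolynomial.aeval_esymm_eq_multiset_esymm, MvPolynomial.psum, MvPolynomial.aeval_X] at this
  simp only [hp]
  exact this

theorem Multiset.psum_eq_of_esymm_eq {F : Type*} [CommRing F] {G H : Multiset F} {d : ℕ}
    (he : ∀ i < d, G.esymm i = H.esymm i) (k : ℕ) (hk : 0 < k) (hkd : k < d) :
    (G.map (· ^ k)).sum = (H.map (· ^ k)).sum := by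
  induction k using Nat.strong_induction_on with
  | _ k ih =>
    rw [G.psum_eq_mul_esymm_sub_sum k hk, H.psum_eq_mul_esymm_sub_sum k hk, he k hkd]
    congr 1
    refine Finset.sum_congr rfl fun a ha => ?_
    obtain ⟨h1, h2, h3⟩ := Finset.mem_filter.1 ha
    rw [Finset.HasAntidiagonal.mem_antidiagonal] at h1
    rw [he _ (by omega), ih a.2 (by omega) (by omega) (by omega)]

theorem Multiset.psum_sub_psum_of_esymm_eq {F : Type*} [CommRing F] {G H : Multiset F} {d : ℕ}
    (he : ∀ i < d, G.esymm i = H.esymm i) (hd : 0 < d) :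
    (G.map (· ^ d)).sum - (H.map (· ^ d)).sum =
      (-1) ^ (d + 1) * d * (G.esymm d - H.esymm d) := by
  rw [G.psum_eq_mul_esymm_sub_sum d hd, H.psum_eq_mul_esymm_sub_sum d hd]
  have : ∑ a ∈ Finset.HasAntidiagonal.antidiagonal d with a.1 ∈ Set.Ioo 0 d,
        (-1) ^ a.1 * G.esymm a.1 * (G.map (· ^ a.2)).sum =
      ∑ a ∈ Finset.HasAntidiagonal.antidiagonal d with a.1 ∈ Set.Ioo 0 d,
        (-1) ^ a.1 * H.esymm a.1 * (H.map (· ^ a.2)).sum := by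
    refine Finset.sum_congr rfl fun a ha => ?_
    obtain ⟨h1, h2, h3⟩ := Finset.mem_filter.1 ha
    rw [Finset.HasAntidiagonal.mem_antidiagonal] at h1
    rw [he _ h3, psum_eq_of_esymm_eq he a.2 (by omega) (by omega)]
  rw [this]
  ring

/-- Translating the coefficient of `X ^ (s - d)` in the monic polynomial with roots `G` shifts
the sum of a degree `d` polynomial over the roots linearly. -/
theorem sum_eval_roots_sub {F : Type*} [Field F] (f : F[X]) (hd : 0 < f.natDegree)
    {G H : Multiset F} (hcard : Multiset.card G = Multiset.card H)
    (hs : f.natDegree ≤ Multiset.card H) (c : F)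
    (hGH : (G.map (X - C ·)).prod =
      (H.map (X - C ·)).prod + C c * X ^ (Multiset.card H - f.natDegree)) :
    (G.map f.eval).sum - (H.map f.eval).sum = -(f.leadingCoeff * f.natDegree * c) := by
  set d := f.natDegree
  have hes : ∀ i ≤ d, G.esymm i - H.esymm i = if i = d then (-1) ^ d * c else 0 := by
    intro i hi
    have h1 := congrArg (fun P => P.coeff (Multiset.card H - i)) hGH
    simp only [coeff_add, coeff_C_mul, coeff_X_pow] at h1
    rw [Multiset.prod_X_sub_C_coeff H (by omega), ← hcard,
      Multiset.prod_X_sub_C_coeff G (by omega), hcard,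
      show Multiset.card H - (Multiset.card H - i) = i by omega] at h1
    have h2 : ((-1 : F) ^ i) * (-1) ^ i = 1 := by
      rw [← mul_pow]; simp
    split_ifs with hid
    · subst hid
      rw [if_pos rfl] at h1
      linear_combination (-1) ^ d * h1 + (H.esymm d - G.esymm d) * h2
    · rw [if_neg (by omega)] at h1
      linear_combination (-1) ^ i * h1 + (H.esymm i - G.esymm i) * h2
  have hlt : ∀ i < d, G.esymm i = H.esymm i := fun i hi => by
    have := hes i hi.le
    rw [if_neg hi.ne] at this
    exact sub_eq_zero.1 this
  have hexp : ∀ M : Multiset F, (M.map f.eval).sum =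
      ∑ k ∈ Finset.range d, f.coeff k * (M.map (· ^ k)).sum +
        f.leadingCoeff * (M.map (· ^ d)).sum := by
    intro M
    rw [show f.leadingCoeff = f.coeff d from rfl, ← Finset.sum_range_succ
      (fun k => f.coeff k * (M.map (· ^ k)).sum)]
    have : f.eval = fun x => ∑ k ∈ Finset.range (d + 1), f.coeff k * x ^ k :=
      funext fun x => eval_eq_sum_range x
    rw [this, Multiset.sum_map_sum]
    exact Finset.sum_congr rfl fun k _ => Multiset.sum_map_mul_left
  have hlow : ∑ k ∈ Finset.range d, f.coeff k * (G.map (· ^ k)).sum =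
      ∑ k ∈ Finset.range d, f.coeff k * (H.map (· ^ k)).sum := by
    refine Finset.sum_congr rfl fun k hk => ?_
    rcases k.eq_zero_or_pos with rfl | hk0
    · simp [hcard]
    · rw [Multiset.psum_eq_of_esymm_eq hlt k hk0 (Finset.mem_range.1 hk)]
  rw [hexp G, hexp H, hlow, add_sub_add_left_eq_sub, ← mul_sub,
    Multiset.psum_sub_psum_of_esymm_eq hlt hd, hes d le_rfl, if_pos rfl]
  have h2 : ((-1 : F) ^ d) * (-1) ^ d = 1 := by
    rw [← mul_pow]; simp
  rw [pow_succ]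
  linear_combination (-f.leadingCoeff * d * c) * h2

theorem exists_finset_invariant_multisets {X : Type*} {σ : X → X} (hσ : Function.Injective σ)
    (Y : ℕ → Finset X) (hY : ∀ r, 1 ≤ r → ∀ α, α ∈ Y r ↔ σ^[r] α = α) :
    ∃ V : ℕ → Finset (Multiset X),
      ∀ s G, G ∈ V s ↔ Multiset.card G = s ∧ G.map σ = G := by
  classical
  refine ⟨fun s => ((s • ((Finset.Icc 1 s).biUnion Y).val).powerset.toFinset).filter
    fun G => Multiset.card G = s ∧ G.map σ = G, fun s G => ?_⟩
  rw [Finset.mem_filter, and_iff_right_iff_imp]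
  rintro ⟨hs, hG⟩
  rw [Multiset.mem_toFinset, Multiset.mem_powerset, Multiset.le_iff_count]
  intro α
  by_cases hα : α ∈ G
  · have h1 := card_periods_eq_count hσ hG hα
    obtain ⟨r, hr⟩ := Finset.card_pos.1 (h1.symm ▸ Multiset.count_pos.2 hα)
    rw [Finset.mem_filter, hs] at hr
    have h2 : α ∈ ((Finset.Icc 1 s).biUnion Y).val :=
      Finset.mem_biUnion.2 ⟨r, hr.1, (hY r (Finset.mem_Icc.1 hr.1).1 α).2 hr.2.1⟩
    rw [Multiset.count_nsmul, Multiset.count_eq_one_of_mem (Finset.nodup _) h2, mul_one, ← hs]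
    exact Multiset.count_le_card _ _
  · rw [Multiset.count_eq_zero_of_notMem hα]
    exact Nat.zero_le _

theorem AddChar.map_multiset_sum_eq_prod {A : Type*} [AddCommMonoid A] (Ψ : AddChar A ℂ)
    (G : Multiset A) : Ψ G.sum = (G.map Ψ).prod := by
  induction G using Multiset.induction_on with
  | empty => simp
  | cons a G ih => simp [AddChar.map_add_eq_mul, ih]

theorem AddChar.map_finset_sum_eq_prod {A ι : Type*} [AddCommMonoid A] (Ψ : AddChar A ℂ)
    (s : Finset ι) (u : ι → A) : Ψ (∑ i ∈ s, u i) = ∏ i ∈ s, Ψ (u i) := by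
  rw [Finset.sum, AddChar.map_multiset_sum_eq_prod, Multiset.map_map]
  rfl

theorem prod_X_sub_C_map_ringHom {F : Type*} [CommRing F] (φ : F →+* F) (G : Multiset F) :
    ((G.map (X - C ·)).prod).map φ = ((G.map φ).map (X - C ·)).prod := by
  rw [Polynomial.map_multiset_prod, Multiset.map_map, Multiset.map_map]
  congr 1
  exact Multiset.map_congr rfl fun a _ => by simp

theorem natDegree_prod_X_sub_C {F : Type*} [Field F] (G : Multiset F) :
    (G.map (X - C ·)).prod.natDegree = Multiset.card G :=
  natDegree_multiset_prod_X_sub_C_eq_card G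

theorem prod_X_sub_C_roots_add {F : Type*} [Field F] [IsAlgClosed F] (G : Multiset F) (c : F)
    {j : ℕ} (hj : j < Multiset.card G) :
    (((G.map (X - C ·)).prod + C c * X ^ j).roots.map (X - C ·)).prod =
      (G.map (X - C ·)).prod + C c * X ^ j := by
  have hm : ((G.map (X - C ·)).prod + C c * X ^ j).Monic := by
    refine (monic_multisetProd_X_sub_C G).add_of_left ?_
    refine (degree_C_mul_X_pow_le _ _).trans_lt ?_
    rw [degree_eq_natDegree (monic_multisetProd_X_sub_C G).ne_zero,
      natDegree_multiset_prod_X_sub_C_eq_card]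
    exact_mod_cast hj
  exact ((IsAlgClosed.splits _).eq_prod_roots_of_monic hm).symm

theorem injective_prod_X_sub_C {F : Type*} [Field F] :
    Function.Injective fun G : Multiset F => (G.map (X - C ·)).prod := fun G H h => by
  simpa [roots_multiset_prod_X_sub_C] using congrArg roots h

theorem sum_character_invariant_multisets_eq_zero {F : Type*} [Field F] [IsAlgClosed F] (φ : F →+* F)
    (f : F[X]) (hd : 0 < f.natDegree) (Ψ : AddChar F ℂ)
    (hΨ : Ψ (-(f.leadingCoeff * f.natDegree)) ≠ 1) (V : ℕ → Finset (Multiset F))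
    (hV : ∀ s G, G ∈ V s ↔ Multiset.card G = s ∧ G.map φ = G) (s : ℕ) (hs : f.natDegree ≤ s) :
    ∑ G ∈ V s, (G.map fun α => Ψ (f.eval α)).prod = 0 := by
  set w : Multiset F → ℂ := fun G => (G.map fun α => Ψ (f.eval α)).prod with hw
  have hwsum : ∀ G, w G = Ψ (G.map f.eval).sum := fun G => by
    rw [AddChar.map_multiset_sum_eq_prod, Multiset.map_map]
    rfl
  set j := s - f.natDegree with hj
  let Φ : F → Multiset F → Multiset F := fun c G =>
    ((G.map (X - C ·)).prod + C c * X ^ j).roots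
  have hΦ : ∀ c, ∀ G ∈ V s, ((Φ c G).map (X - C ·)).prod =
      (G.map (X - C ·)).prod + C c * X ^ j := fun c G hG =>
    prod_X_sub_C_roots_add G c (by rw [((hV s G).1 hG).1]; omega)
  have hcard : ∀ c, ∀ G ∈ V s, Multiset.card (Φ c G) = s := fun c G hG => by
    have h1 := congrArg natDegree (hΦ c G hG)
    rw [natDegree_prod_X_sub_C] at h1
    rw [h1, natDegree_add_eq_left_of_natDegree_lt, natDegree_prod_X_sub_C, ((hV s G).1 hG).1]
    rw [natDegree_prod_X_sub_C, ((hV s G).1 hG).1]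
    exact (natDegree_C_mul_X_pow_le _ _).trans_lt (by omega)
  have hmem : ∀ c, φ c = c → ∀ G ∈ V s, Φ c G ∈ V s := fun c hc G hG => by
    refine (hV s _).2 ⟨hcard c G hG, injective_prod_X_sub_C ?_⟩
    simp only
    rw [← prod_X_sub_C_map_ringHom, hΦ c G hG, Polynomial.map_add, prod_X_sub_C_map_ringHom,
      ((hV s G).1 hG).2]
    simp [hc]
  have hinv : ∀ c, φ c = c → ∀ G ∈ V s, Φ (-c) (Φ c G) = G := fun c hc G hG => by
    refine injective_prod_X_sub_C ?_
    simp only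
    rw [hΦ _ _ (hmem c hc G hG), hΦ c G hG]
    simp
  have hshift : ∀ G ∈ V s, w (Φ 1 G) = Ψ (-(f.leadingCoeff * f.natDegree)) * w G :=
    fun G hG => by
    have h1 := sum_eval_roots_sub f hd (G := Φ 1 G) (H := G)
      (by rw [hcard 1 G hG, ((hV s G).1 hG).1]) (by rw [((hV s G).1 hG).1]; exact hs) 1
      (by rw [((hV s G).1 hG).1]; exact hΦ 1 G hG)
    rw [hwsum, hwsum, ← AddChar.map_add_eq_mul]
    congr 1
    rw [mul_one] at h1
    rw [← h1]
    ring
  have key : ∑ G ∈ V s, w G = Ψ (-(f.leadingCoeff * f.natDegree)) * ∑ G ∈ V s, w G := by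
    rw [Finset.mul_sum]
    symm
    refine Finset.sum_nbij' (Φ 1) (Φ (-1)) (hmem 1 (map_one φ)) (hmem (-1) (by simp))
      (hinv 1 (map_one φ)) (fun G hG => ?_) fun G hG => (hshift G hG).symm
    simpa using hinv (-1) (by simp) G hG
  have : (1 - Ψ (-(f.leadingCoeff * f.natDegree))) * ∑ G ∈ V s, w G = 0 := by
    rw [sub_mul, one_mul, ← key, sub_self]
  exact (mul_eq_zero.1 this).resolve_left (sub_ne_zero.2 hΨ.symm)

theorem exists_finset_pow_eq_self (F : Type*) [Field F] [IsAlgClosed F] (p : ℕ) [hp : Fact p.Prime]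
    [CharP F p] (r : ℕ) (hr : 1 ≤ r) :
    ∃ Y : Finset F, (∀ α, α ∈ Y ↔ α ^ p ^ r = α) ∧ Y.card = p ^ r := by
  classical
  have hq : 1 < p ^ r := Nat.one_lt_pow (by omega) hp.out.one_lt
  have hsep : (X ^ p ^ r - X : F[X]).Separable :=
    galois_poly_separable p _ (dvd_pow_self p (by omega))
  refine ⟨(X ^ p ^ r - X : F[X]).roots.toFinset, fun α => ?_, ?_⟩
  · rw [Multiset.mem_toFinset, mem_roots (FiniteField.X_pow_card_sub_X_ne_zero F hq)]
    simp [sub_eq_zero]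
  · rw [Multiset.toFinset_card_of_nodup (nodup_roots hsep),
      ← (IsAlgClosed.splits _).natDegree_eq_card_roots,
      FiniteField.X_pow_card_sub_X_natDegree_eq F hq]

theorem sum_eq_neg_of_card_le {ι : Type*} [Fintype ι] (N : ι → ℕ) (B : ℕ)
    (hN : ∀ i, N i ≤ B) (χ : ι → ℂ) (hχ : ∀ i, ‖χ i‖ ≤ 1) (h0 : ∑ i, χ i = 0) :
    ‖∑ i, (N i : ℂ) * χ i‖ ≤ (Fintype.card ι : ℝ) * B - ∑ i, (N i : ℝ) := by
  have h1 : ∑ i, (N i : ℂ) * χ i = -∑ i, ((B : ℂ) - N i) * χ i := by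
    simp only [sub_mul, Finset.sum_sub_distrib, ← Finset.mul_sum, h0]
    ring
  rw [h1, norm_neg]
  refine (norm_sum_le _ _).trans ?_
  calc ∑ i, ‖((B : ℂ) - N i) * χ i‖ ≤ ∑ i, ((B : ℝ) - N i) := by
        refine Finset.sum_le_sum fun i _ => ?_
        have h2 : ((B : ℂ) - N i) = (((B - N i : ℕ) : ℝ) : ℂ) := by
          push_cast [Nat.cast_sub (hN i)]
          ring
        rw [norm_mul, h2, Complex.norm_real, Real.norm_of_nonneg (by positivity),
          Nat.cast_sub (hN i)]
        exact mul_le_of_le_one_right (by simpa using hN i) (hχ i)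
    _ = _ := by simp [Finset.sum_sub_distrib]

theorem iterate_frobenius_eq_pow {p : ℕ} [hp : Fact p.Prime] {F : Type*} [Field F]
    [CharP F p] (r : ℕ) (α : F) : (frobenius F p)^[r] α = α ^ p ^ r := by
  induction r with
  | zero => simp
  | succ r ih => rw [Function.iterate_succ_apply', ih, frobenius_def, ← pow_mul, pow_succ]

theorem pow_prime_eq_self_iff {p : ℕ} [hp : Fact p.Prime] {F : Type*} [Field F]
    [Algebra (ZMod p) F] (x : F) : x ^ p = x ↔ ∃ u : ZMod p, algebraMap (ZMod p) F u = x := by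
  classical
  refine ⟨fun h => ?_, ?_⟩
  · by_contra! hx
    have h1 : (X ^ p - X : F[X]) ≠ 0 := FiniteField.X_pow_card_sub_X_ne_zero F hp.out.one_lt
    have h2 : insert x (Finset.univ.image (algebraMap (ZMod p) F)) ⊆
        (X ^ p - X : F[X]).roots.toFinset := by
      intro y hy
      rw [Multiset.mem_toFinset, mem_roots h1]
      rcases Finset.mem_insert.1 hy with rfl | hy
      · simp [h]
      · obtain ⟨u, -, rfl⟩ := Finset.mem_image.1 hy
        simp [← map_pow, ZMod.pow_card]
    have h3 := (Finset.card_le_card h2).trans ((Multiset.toFinset_card_le _).trans (card_roots' _))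
    rw [Finset.card_insert_of_notMem (by simpa using hx),
      Finset.card_image_of_injective _ (algebraMap (ZMod p) F).injective,
      FiniteField.X_pow_card_sub_X_natDegree_eq F hp.out.one_lt, Finset.card_univ, ZMod.card] at h3
    omega
  · rintro ⟨u, rfl⟩
    rw [← map_pow, ZMod.pow_card]

theorem eval_map_pow_prime_pow {p : ℕ} [hp : Fact p.Prime] {F : Type*} [Field F]
    [Algebra (ZMod p) F] [CharP F p] (g : (ZMod p)[X]) (α : F) (i : ℕ) :
    (g.map (algebraMap (ZMod p) F)).eval (α ^ p ^ i) =
      ((g.map (algebraMap (ZMod p) F)).eval α) ^ p ^ i := by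
  induction i with
  | zero => simp
  | succ i ih =>
    have : ∀ β : F, (g.map (algebraMap (ZMod p) F)).eval (β ^ p) =
        ((g.map (algebraMap (ZMod p) F)).eval β) ^ p := fun β => by
      rw [eval_map, eval_map, eval₂_eq_sum_range, eval₂_eq_sum_range, sum_pow_char]
      refine Finset.sum_congr rfl fun j _ => ?_
      rw [mul_pow, ← map_pow, ZMod.pow_card, ← pow_mul, ← pow_mul, mul_comm j p]
    rw [pow_succ, pow_mul, this, ih, ← pow_mul]

theorem sum_iterate_pow_prime_eq_self {p : ℕ} [hp : Fact p.Prime] {F : Type*} [Field F]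
    [CharP F p] {r : ℕ} {β : F} (hβ : β ^ p ^ r = β) :
    (∑ i ∈ Finset.range r, β ^ p ^ i) ^ p = ∑ i ∈ Finset.range r, β ^ p ^ i := by
  rw [sum_pow_char]
  have h1 := Finset.sum_range_succ' (fun i => β ^ p ^ i) r
  rw [Finset.sum_range_succ, hβ] at h1
  simp only [← pow_mul, ← pow_succ]
  simpa using h1.symm

/-- The Stepanov bound turned into a bound for the character sums over the even extensions. -/
theorem norm_sum_trace_le {p : ℕ} [hp : Fact p.Prime] {F : Type*} [Field F]
    [IsAlgClosed F] [Algebra (ZMod p) F] [CharP F p] (g : (ZMod p)[X]) (hd : 0 < g.natDegree)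
    (hpd : ¬ p ∣ g.natDegree) (ψ : AddChar (ZMod p) ℂ) (hψ : ψ ≠ 1) (l : F →+ ZMod p)
    (hl : ∀ u, l (algebraMap (ZMod p) F u) = u) (k : ℕ) (Y : Finset F)
    (hY : ∀ α, α ∈ Y ↔ α ^ p ^ (2 * (k + 1)) = α) (hYc : Y.card = p ^ (2 * (k + 1))) :
    ‖∑ α ∈ Y, ∏ i ∈ Finset.range (2 * (k + 1)),
        ψ (l ((g.map (algebraMap (ZMod p) F)).eval (α ^ p ^ i)))‖ ≤
      2 * g.natDegree * p * p ^ (k + 1) := by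
  classical
  set f := g.map (algebraMap (ZMod p) F) with hf
  have hfd : f.natDegree = g.natDegree := natDegree_map _
  set T : F → F := fun α => ∑ i ∈ Finset.range (2 * (k + 1)), f.eval α ^ p ^ i with hT
  have hTl : ∀ α ∈ Y, algebraMap (ZMod p) F (l (T α)) = T α := fun α hα => by
    obtain ⟨u, hu⟩ := (pow_prime_eq_self_iff (T α)).1 (sum_iterate_pow_prime_eq_self (by
      rw [← eval_map_pow_prime_pow, (hY α).1 hα]))
    rw [← hu, hl]
  have h1 : ∑ α ∈ Y, ∏ i ∈ Finset.range (2 * (k + 1)), ψ (l (f.eval (α ^ p ^ i))) =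
      ∑ u : ZMod p, ((Y.filter fun α => l (T α) = u).card : ℂ) * ψ u := by
    have h2 : ∀ α ∈ Y, ∏ i ∈ Finset.range (2 * (k + 1)), ψ (l (f.eval (α ^ p ^ i))) =
        ψ (l (T α)) := fun α _ => by
      rw [hT, map_sum, AddChar.map_finset_sum_eq_prod]
      exact Finset.prod_congr rfl fun i _ => by rw [eval_map_pow_prime_pow]
    rw [Finset.sum_congr rfl h2, ← Finset.sum_fiberwise Y (fun α => l (T α))]
    refine Finset.sum_congr rfl fun u _ => ?_
    rw [Finset.sum_congr rfl fun α hα => by rw [(Finset.mem_filter.1 hα).2], Finset.sum_const,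
      nsmul_eq_mul]
  rw [h1]
  refine (sum_eq_neg_of_card_le _ (p ^ (2 * k + 1) + 2 * g.natDegree * p ^ (k + 1)) (fun u => ?_) ψ
    (fun u => (AddChar.norm_apply ψ u).le) (AddChar.sum_eq_zero_of_ne_one hψ)).trans_eq ?_
  · rw [← hfd]
    refine card_trace_eq_le p f (by omega) (by rwa [hfd]) k (algebraMap (ZMod p) F u) _
      fun α hα => ?_
    rw [Finset.mem_filter] at hα
    exact ⟨(hY α).1 hα.1, by rw [← hα.2]; exact (hTl α hα.1).symm⟩
  · have h3 := Finset.card_eq_sum_card_fiberwise (s := Y) (t := Finset.univ)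
      (f := fun α => l (T α)) (fun _ _ => Finset.mem_coe.2 (Finset.mem_univ _))
    rw [ZMod.card, ← Nat.cast_sum, ← h3, hYc]
    push_cast
    ring

theorem norm_multiset_sum_le_card_mul (ω : Multiset ℂ) {B : ℝ} (h : ∀ z ∈ ω, ‖z‖ ≤ B) :
    ‖ω.sum‖ ≤ Multiset.card ω * B := by
  induction ω using Multiset.induction_on with
  | empty => simp
  | cons a ω ih =>
    rw [Multiset.sum_cons, Multiset.card_cons]
    push_cast
    linarith [norm_add_le a ω.sum, h a (Multiset.mem_cons_self _ _),
      ih fun z hz => h z (Multiset.mem_cons_of_mem hz)]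

/-- The Weil bound for additive character sums over the prime field. -/
theorem norm_sum_character_eval_le {p : ℕ} [hp : Fact p.Prime] (g : (ZMod p)[X])
    (hd : 0 < g.natDegree) (hpd : ¬ p ∣ g.natDegree) (ψ : AddChar (ZMod p) ℂ)
    (hψ : Function.Injective ψ) :
    ‖∑ x, ψ (g.eval x)‖ ≤ (g.natDegree - 1 : ℕ) * √p := by
  classical
  set F := AlgebraicClosure (ZMod p)
  have : CharP F p := charP_of_injective_algebraMap (algebraMap (ZMod p) F).injective p
  have hψ1 : ψ ≠ 1 := fun h => one_ne_zero (hψ (a₁ := (1 : ZMod p)) (a₂ := 0) (by simp [h]))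
  obtain ⟨l, hl⟩ := LinearMap.exists_leftInverse_of_injective (Algebra.linearMap (ZMod p) F)
    (LinearMap.ker_eq_bot.2 (algebraMap (ZMod p) F).injective)
  have hl' : ∀ u, l.toAddMonoidHom (algebraMap (ZMod p) F u) = u := fun u => LinearMap.congr_fun hl u
  choose! Y hY hYc using exists_finset_pow_eq_self F p
  have hσ : Function.Injective (frobenius F p) := frobenius_inj F p
  have hYσ : ∀ r, 1 ≤ r → ∀ α, α ∈ Y r ↔ (frobenius F p)^[r] α = α := fun r hr α => by
    rw [iterate_frobenius_eq_pow, hY r hr]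
  obtain ⟨V, hV⟩ := exists_finset_invariant_multisets hσ Y hYσ
  set f := g.map (algebraMap (ZMod p) F) with hf
  have hfd : f.natDegree = g.natDegree := natDegree_map _
  set Ψ : AddChar F ℂ := ψ.compAddMonoidHom l.toAddMonoidHom
  have hg0 : g ≠ 0 := fun h => by simp [h] at hd
  have hΨ : Ψ (-(f.leadingCoeff * f.natDegree)) ≠ 1 := by
    have h1 : -(f.leadingCoeff * f.natDegree) =
        algebraMap (ZMod p) F (-(g.leadingCoeff * g.natDegree)) := by
      rw [hfd, hf, leadingCoeff_map]
      simp
    rw [h1, AddChar.compAddMonoidHom_apply, hl', ← ψ.map_zero_eq_one]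
    refine fun h => ?_
    have h2 := hψ h
    rw [neg_eq_zero, mul_eq_zero, leadingCoeff_eq_zero, ZMod.natCast_eq_zero_iff] at h2
    tauto
  set w : F → ℂ := fun α => Ψ (f.eval α) with hw
  obtain ⟨ω, hωc, hω⟩ := exists_power_sums_of_recurrence
    (fun s => ∑ G ∈ V s, (G.map w).prod)
    (fun r => ∑ α ∈ Y r, ∏ i ∈ Finset.range r, w ((frobenius F p)^[i] α)) g.natDegree hd
    (by
      have : V 0 = {0} := by
        ext G
        rw [hV, Multiset.card_eq_zero, Finset.mem_singleton, and_iff_left_iff_imp]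
        rintro rfl
        simp
      simp [this])
    (fun s hs => sum_character_invariant_multisets_eq_zero (frobenius F p) f (by omega) Ψ hΨ V hV s
      (by omega))
    (card_mul_sum_invariant_multisets hσ Y hYσ V hV w)
  have hsq : ∀ z ∈ ω, ‖z‖ ≤ √p := by
    have h1 := norm_le_of_norm_power_sum_le (ω.map (· ^ 2)) (2 * g.natDegree * p) p
      (by exact_mod_cast hp.out.pos) fun n hn => by
        obtain ⟨k, rfl⟩ : ∃ k, n = k + 1 := ⟨n - 1, by omega⟩
        have h2 := norm_sum_trace_le g hd hpd ψ hψ1 l.toAddMonoidHom hl' k (Y (2 * (k + 1)))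
          (hY _ (by omega)) (hYc _ (by omega))
        have h3 := hω (2 * (k + 1)) (by omega)
        simp only [iterate_frobenius_eq_pow] at h3
        rw [Multiset.map_map, ← norm_neg]
        simp only [Function.comp_def, ← pow_mul]
        rw [← h3]
        exact h2
    intro z hz
    refine Real.le_sqrt_of_sq_le ?_
    rw [← norm_pow]
    exact h1 _ (Multiset.mem_map_of_mem _ hz)
  have hS1 := hω 1 le_rfl
  have hY1 : Y 1 = Finset.univ.image (algebraMap (ZMod p) F) := by
    ext α
    rw [hY 1 le_rfl, pow_one, pow_prime_eq_self_iff]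
    simp
  rw [hY1, Finset.sum_image fun _ _ _ _ h => (algebraMap (ZMod p) F).injective h] at hS1
  simp only [Finset.range_one, Finset.prod_singleton, Function.iterate_zero, id, pow_one,
    Multiset.map_id'] at hS1
  have h4 : ∀ x : ZMod p, w (algebraMap (ZMod p) F x) = ψ (g.eval x) := fun x => by
    rw [hw]
    simp only
    rw [hf, eval_map_algebraMap, aeval_algebraMap_apply_eq_algebraMap_eval,
      AddChar.compAddMonoidHom_apply, hl']
  simp only [h4] at hS1
  rw [hS1, norm_neg]
  refine (norm_multiset_sum_le_card_mul ω hsq).trans ?_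
  gcongr
  omega

theorem sum_range_mul_eq_sum_sum {M : Type*} [AddCommMonoid M] (a b : ℕ) (F : ℕ → M) :
    ∑ x ∈ Finset.range (a * b), F x =
      ∑ c ∈ Finset.range a, ∑ y ∈ Finset.range b, F (c + a * y) := by
  induction b with
  | zero => simp
  | succ b ih =>
    rw [Nat.mul_succ, Finset.sum_range_add, ih, ← Finset.sum_add_distrib]
    refine Finset.sum_congr rfl fun c _ => ?_
    rw [Finset.sum_range_succ, add_comm c]

theorem sum_range_mul_of_periodic (a b : ℕ) (F : ℕ → ℂ) (hF : Function.Periodic F a) :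
    ∑ x ∈ Finset.range (a * b), F x = b * ∑ c ∈ Finset.range a, F c := by
  rw [sum_range_mul_eq_sum_sum, Finset.mul_sum]
  refine Finset.sum_congr rfl fun c _ => ?_
  have h1 : ∀ y : ℕ, F (c + a * y) = F c := fun y => by
    rw [mul_comm]
    exact hF.nat_mul y c
  simp [h1]

theorem sum_range_add_of_periodic (N t : ℕ) (F : ℕ → ℂ) (hF : Function.Periodic F N) :
    ∑ x ∈ Finset.range N, F (x + t) = ∑ x ∈ Finset.range N, F x := by
  induction t with
  | zero => rfl
  | succ t ih =>
    rw [← ih]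
    have h1 := Finset.sum_range_succ' (fun x => F (x + t)) N
    rw [Finset.sum_range_succ, add_comm N t, hF t, zero_add] at h1
    rw [add_right_cancel h1]
    exact Finset.sum_congr rfl fun x _ => by congr 1; ring

theorem sum_range_natCast_eq_sum_zmod (N : ℕ) [NeZero N] (F : ZMod N → ℂ) :
    ∑ x ∈ Finset.range N, F x = ∑ x : ZMod N, F x :=
  Finset.sum_bij' (fun x _ => (x : ZMod N)) (fun x _ => x.val) (fun _ _ => Finset.mem_univ _)
    (fun x _ => Finset.mem_range.2 x.val_lt)
    (fun _ hx => ZMod.val_cast_of_lt (Finset.mem_range.1 hx)) (fun x _ => ZMod.natCast_zmod_val x)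
    fun _ _ => rfl

theorem periodic_stdAddChar_eval (N : ℕ) [NeZero N] (f : ℤ[X]) :
    Function.Periodic
      (fun x : ℕ => (ZMod.stdAddChar ((f.eval (x : ℤ) : ℤ) : ZMod N) : ℂ)) N := fun x => by
  simp only
  congr 1
  rw [ZMod.intCast_eq_intCast_iff_dvd_sub]
  have := Polynomial.sub_dvd_eval_sub (x : ℤ) ((x + N : ℕ) : ℤ) f
  rw [← dvd_neg, neg_sub]
  refine Dvd.dvd.trans ⟨-1, ?_⟩ ((dvd_neg.2 this).trans (by rw [neg_sub]))
  push_cast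
  ring

theorem expSum_eq_sum_stdAddChar (p m : ℕ) [NeZero (p ^ m)] (f : ℤ[X]) :
    expSum p m f = ((p : ℂ) ^ m)⁻¹ * ∑ x ∈ Finset.range (p ^ m),
      (ZMod.stdAddChar ((f.eval (x : ℤ) : ℤ) : ZMod (p ^ m)) : ℂ) := by
  simp only [expSum, ZMod.stdAddChar_coe, Nat.cast_pow]

theorem norm_expSum_le_one (p m : ℕ) [NeZero p] (f : ℤ[X]) : ‖expSum p m f‖ ≤ 1 := by
  rw [expSum_eq_sum_stdAddChar, norm_mul, norm_inv, norm_pow, Complex.norm_natCast]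
  have hp : (0 : ℝ) < (p : ℝ) ^ m := by
    have := NeZero.pos p
    positivity
  rw [inv_mul_le_one₀ hp]
  refine (norm_sum_le _ _).trans ?_
  simp only [AddChar.norm_apply]
  simp

theorem norm_expSum_C_add_C_mul (p m : ℕ) [NeZero p] (c : ℤ) (g : ℤ[X]) :
    ‖expSum p (m + 1) (C c + C (p : ℤ) * g)‖ = ‖expSum p m g‖ := by
  have hp : (p : ℂ) ≠ 0 := Nat.cast_ne_zero.2 (NeZero.ne p)
  have h1 : expSum p (m + 1) (C c + C (p : ℤ) * g) =
      (ZMod.stdAddChar ((c : ℤ) : ZMod (p ^ (m + 1))) : ℂ) * expSum p m g := by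
    rw [expSum_eq_sum_stdAddChar p m, expSum_eq_sum_stdAddChar p (m + 1)]
    have h2 : ∀ x : ℕ, (ZMod.stdAddChar
        (((C c + C (p : ℤ) * g).eval (x : ℤ) : ℤ) : ZMod (p ^ (m + 1))) : ℂ) =
        ZMod.stdAddChar ((c : ℤ) : ZMod (p ^ (m + 1))) *
          ZMod.stdAddChar ((g.eval (x : ℤ) : ℤ) : ZMod (p ^ m)) := fun x => by
      simp only [ZMod.stdAddChar_coe, ← Complex.exp_add, eval_add, eval_mul, eval_C]
      congr 1
      push_cast
      field_simp
      ring
    simp only [h2, ← Finset.mul_sum]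
    have h3 := sum_range_mul_of_periodic (p ^ m) p _ (periodic_stdAddChar_eval _ g)
    rw [← pow_succ] at h3
    rw [h3]
    field_simp
    ring
  rw [h1, norm_mul, AddChar.norm_apply, one_mul]

theorem expSum_eq_sum_comp (p m : ℕ) [NeZero p] (f : ℤ[X]) :
    expSum p (m + 1) f =
      (p : ℂ)⁻¹ * ∑ c ∈ Finset.range p,
        expSum p (m + 1) (f.comp (C (c : ℤ) + C (p : ℤ) * X)) := by
  have hp : (p : ℂ) ≠ 0 := Nat.cast_ne_zero.2 (NeZero.ne p)
  simp only [expSum_eq_sum_stdAddChar]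
  have h1 := periodic_stdAddChar_eval (p ^ (m + 1)) f
  set H : ℕ → ℂ := fun x => ZMod.stdAddChar ((f.eval (x : ℤ) : ℤ) : ZMod (p ^ (m + 1))) with hH
  have h2 : ∀ c : ℕ, ∑ y ∈ Finset.range (p ^ (m + 1)), (ZMod.stdAddChar
      (((f.comp (C (c : ℤ) + C (p : ℤ) * X)).eval (y : ℤ) : ℤ) : ZMod (p ^ (m + 1))) : ℂ) =
      p * ∑ y ∈ Finset.range (p ^ m), H (c + p * y) := fun c => by
    have h3 := sum_range_mul_of_periodic (p ^ m) p (fun y => H (c + p * y)) fun y => by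
      simp only
      rw [mul_add, ← add_assoc, ← pow_succ']
      exact h1 _
    rw [← h3, ← pow_succ]
    refine Finset.sum_congr rfl fun y _ => ?_
    simp only [hH, eval_comp, eval_add, eval_C, eval_mul, eval_X]
    push_cast
    rfl
  have h4 := sum_range_mul_eq_sum_sum p (p ^ m) H
  rw [← pow_succ'] at h4
  simp only [h2]
  change _ * ∑ i ∈ Finset.range (p ^ (m + 1)), H i = _
  rw [h4, ← Finset.mul_sum, ← Finset.mul_sum]
  field_simp

theorem expSum_comp_eq_zero {p : ℕ} [hp : Fact p.Prime] (m : ℕ) (f : ℤ[X]) (c : ℤ)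
    (hc : ¬ (p : ℤ) ∣ f.derivative.eval c) :
    expSum p (m + 2) (f.comp (C c + C (p : ℤ) * X)) = 0 := by
  rw [expSum_eq_sum_stdAddChar]
  set N := p ^ (m + 2) with hN
  set H : ℕ → ℂ := fun y => ZMod.stdAddChar
    (((f.comp (C c + C (p : ℤ) * X)).eval (y : ℤ) : ℤ) : ZMod N) with hH
  set ζ : ℂ := ZMod.stdAddChar (((p : ℤ) ^ (m + 1) * f.derivative.eval c : ℤ) : ZMod N) with hζ
  have hζ1 : ζ ≠ 1 := fun h => by
    rw [hζ, ← (ZMod.stdAddChar (N := N)).map_zero_eq_one] at h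
    have h1 := ZMod.injective_stdAddChar h
    rw [ZMod.intCast_zmod_eq_zero_iff_dvd, hN, Nat.cast_pow, pow_succ _ (m + 1)] at h1
    exact hc (Int.dvd_of_mul_dvd_mul_left (pow_ne_zero _ (by exact_mod_cast hp.out.ne_zero)) h1)
  have hstep : ∀ y, H (y + p ^ m) = ζ * H y := fun y => by
    simp only [hH, hζ, ← AddChar.map_add_eq_mul]
    rw [← Int.cast_add]
    congr 1
    rw [ZMod.intCast_eq_intCast_iff_dvd_sub, ← dvd_neg, neg_sub]
    simp only [eval_comp, eval_add, eval_C, eval_mul, eval_X]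
    obtain ⟨k, hk⟩ := Polynomial.binomExpansion f (c + p * y) ((p : ℤ) ^ (m + 1))
    obtain ⟨l, hl⟩ := Polynomial.sub_dvd_eval_sub (c + p * y) c f.derivative
    have h1 : c + (p : ℤ) * ((y + p ^ m : ℕ) : ℤ) = c + p * y + (p : ℤ) ^ (m + 1) := by
      push_cast
      ring
    have h2 : f.derivative.eval (c + p * y) = f.derivative.eval c + p * y * l := by
      linear_combination hl
    rw [h1, hk, h2, hN]
    refine ⟨y * l + k * (p : ℤ) ^ m, ?_⟩
    push_cast
    ring
  have h1 := sum_range_add_of_periodic N (p ^ m) H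
    (periodic_stdAddChar_eval N (f.comp (C c + C (p : ℤ) * X)))
  simp only [hstep, ← Finset.mul_sum] at h1
  have h2 : (ζ - 1) * ∑ y ∈ Finset.range N, H y = 0 := by
    rw [sub_mul, one_mul, h1, sub_self]
  rw [(mul_eq_zero.1 h2).resolve_left (sub_ne_zero.2 hζ1), mul_zero]

theorem norm_expSum_one_le {p : ℕ} [hp : Fact p.Prime] (f : ℤ[X]) (hf : f.natDegree < p)
    (hf' : ¬ ∀ i, (p : ℤ) ∣ f.derivative.coeff i) :
    ‖expSum p 1 f‖ ≤ f.natDegree * (√p)⁻¹ := by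
  have hp0 : (0 : ℝ) < p := by exact_mod_cast hp.out.pos
  set g : (ZMod p)[X] := f.map (Int.castRingHom (ZMod p)) with hg
  have hgd : 0 < g.natDegree := by
    rw [Nat.pos_iff_ne_zero]
    intro h
    refine hf' fun i => ?_
    rw [← ZMod.intCast_zmod_eq_zero_iff_dvd, ← eq_intCast (Int.castRingHom (ZMod p)), ← coeff_map,
      ← derivative_map, ← hg, natDegree_eq_zero.1 h |>.choose_spec.symm]
    simp
  have hgf : g.natDegree ≤ f.natDegree := natDegree_map_le
  have h1 := norm_sum_character_eval_le g hgd
    (fun h => by have := Nat.le_of_dvd hgd h; omega) ZMod.stdAddChar ZMod.injective_stdAddChar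
  have h2 : expSum p 1 f = (p : ℂ)⁻¹ * ∑ x : ZMod p, ZMod.stdAddChar (g.eval x) := by
    rw [← sum_range_natCast_eq_sum_zmod p fun x => ZMod.stdAddChar (g.eval x), expSum, pow_one,
      pow_one]
    congr 1
    refine Finset.sum_congr rfl fun x _ => ?_
    rw [← ZMod.stdAddChar_coe]
    congr 1
    rw [hg, ← Int.cast_natCast (R := ZMod p), eval_intCast_map]
    rfl
  rw [h2, norm_mul, norm_inv, Complex.norm_natCast]
  calc (p : ℝ)⁻¹ * _ ≤ (p : ℝ)⁻¹ * ((g.natDegree - 1 : ℕ) * √p) := by gcongr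
    _ = (g.natDegree - 1 : ℕ) * (√p)⁻¹ := by
      have := Real.mul_self_sqrt hp0.le
      have h3 : √(p : ℝ) ≠ 0 := (Real.sqrt_pos.2 hp0).ne'
      field_simp
      nlinarith
    _ ≤ _ := by
      gcongr
      omega

theorem gaussNorm_X_sub_C {K : Type*} [Field K] (v : AbsoluteValue K ℝ) (a : K) : (X - C a).gaussNorm v 1 = max 1 (v a) := by
  refine le_antisymm ?_ (max_le ?_ ?_)
  · obtain ⟨i, hi⟩ := exists_eq_gaussNorm v 1 (X - C a)
    rw [hi, one_pow, mul_one, coeff_sub, coeff_X, coeff_C]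
    rcases i with - | i
    · simp
    · rcases i with - | i <;> simp
  · have h := le_gaussNorm v (X - C a) zero_le_one 1
    rw [one_pow, mul_one, coeff_sub, coeff_X, coeff_C] at h
    simpa using h
  · have h := le_gaussNorm v (X - C a) zero_le_one 0
    rw [one_pow, mul_one, coeff_sub, coeff_X, coeff_C] at h
    simpa using h

theorem gaussNorm_C_mul_prod {K ι : Type*} [Field K] {v : AbsoluteValue K ℝ}
    (hna : IsNonarchimedean v) (A : K) (s : Finset ι) (r : ι → K) (e : ι → ℕ) :
    (C A * ∏ i ∈ s, (X - C (r i)) ^ e i).gaussNorm v 1 =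
      v A * ∏ i ∈ s, max 1 (v (r i)) ^ e i := by
  classical
  have hpow : ∀ (a : K) (n : ℕ), ((X - C a) ^ n).gaussNorm v 1 = max 1 (v a) ^ n := fun a n => by
    induction n with
    | zero => simpa using gaussNorm_C v 1 (1 : K)
    | succ n ih => rw [pow_succ, gaussNorm_mul hna one_pos, ih, gaussNorm_X_sub_C, pow_succ]
  induction s using Finset.induction_on with
  | empty => simp
  | insert i s hi ih =>
    rw [Finset.prod_insert hi, mul_left_comm, gaussNorm_mul hna one_pos, ih, hpow,
      Finset.prod_insert hi, mul_left_comm]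

theorem gaussNorm_map_intCast_le_one {K : Type*} [Field K] {v : AbsoluteValue K ℝ}
    (hint : ∀ n : ℤ, v n ≤ 1) (f : ℤ[X]) : (f.map (Int.castRingHom K)).gaussNorm v 1 ≤ 1 := by
  obtain ⟨i, hi⟩ := exists_eq_gaussNorm v 1 (f.map (Int.castRingHom K))
  rw [hi, one_pow, mul_one, coeff_map]
  exact hint _

theorem map_sub_le_max_of_isNonarchimedean {K : Type*} [Field K] {v : AbsoluteValue K ℝ}
    (hna : IsNonarchimedean v) (x y : K) : v (x - y) ≤ max (v x) (v y) := by
  rw [sub_eq_add_neg, ← v.map_neg y]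
  exact hna _ _

theorem exists_map_mul_prod_erase_le {K ι : Type*} [Field K] [DecidableEq ι] {v : AbsoluteValue K ℝ}
    (hna : IsNonarchimedean v) (A : K) (s : Finset ι) (hs : s.Nonempty) (r : ι → K) (e : ι → ℕ) :
    ∃ i ∈ s, v (A * ∏ j ∈ s.erase i, (r i - r j) ^ e j) ≤
      v A * ∏ i ∈ s, max 1 (v (r i)) ^ e i := by
  obtain ⟨i, hi, hmin⟩ := s.exists_min_image (fun i => v (r i)) hs
  refine ⟨i, hi, ?_⟩
  rw [map_mul, map_prod]
  gcongr ?_ * ?_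
  rw [← Finset.mul_prod_erase s _ hi]
  refine (Finset.prod_le_prod (fun j _ => v.nonneg _) fun j hj => ?_).trans
    (le_mul_of_one_le_left (Finset.prod_nonneg fun j _ => by positivity)
      (one_le_pow₀ (le_max_left _ _)))
  rw [map_pow]
  refine pow_le_pow_left₀ (v.nonneg _) ?_ _
  refine (map_sub_le_max_of_isNonarchimedean hna _ _).trans ?_
  rw [max_eq_right (hmin j (Finset.mem_of_mem_erase hj))]
  exact le_max_right _ _

theorem exists_map_sub_lt_one {K ι : Type*} [Field K] {v : AbsoluteValue K ℝ}
    (hna : IsNonarchimedean v) (A c : K) (hc : v c ≤ 1) (s : Finset ι) (r : ι → K) (e : ι → ℕ)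
    (hlt : v (A * ∏ i ∈ s, (c - r i) ^ e i) < v A * ∏ i ∈ s, max 1 (v (r i)) ^ e i) :
    ∃ i ∈ s, v (r i - c) < 1 := by
  by_contra! h
  refine hlt.not_ge ?_
  rw [map_mul, map_prod]
  gcongr with i hi
  rw [map_pow]
  gcongr
  rw [v.map_sub c]
  refine max_le (h i hi) ?_
  have h1 := hna (r i - c) c
  rw [sub_add_cancel] at h1
  exact h1.trans (max_le le_rfl (hc.trans (h i hi)))

theorem exists_comp_eq_C_add_C_mul (f : ℤ[X]) (c : ℤ) {q : ℤ} (hq : q ≠ 0) :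
    ∃ h : ℤ[X], f.comp (C c + C q * X) = C (f.eval c) + C q * h ∧ h.natDegree ≤ f.natDegree ∧
      h.derivative = f.derivative.comp (C c + C q * X) := by
  have hq' : (C q : ℤ[X]) ≠ 0 := C_ne_zero.2 hq
  obtain ⟨g, hg⟩ := X_sub_C_dvd_sub_C_eval (a := c) (p := f)
  have h1 : f.comp (C c + C q * X) = C (f.eval c) + C q * (X * g.comp (C c + C q * X)) := by
    rw [sub_eq_iff_eq_add] at hg
    conv_lhs => rw [hg]
    simp
    ring
  refine ⟨_, h1, ?_, ?_⟩
  · rw [← natDegree_C_mul hq, ← add_sub_cancel_left (C (f.eval c)) (C q * _), ← h1,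
      natDegree_sub_C]
    refine natDegree_comp_le.trans (mul_le_of_le_one_right (Nat.zero_le _) ?_)
    compute_degree
  · have h2 := congrArg derivative h1
    rw [derivative_comp] at h2
    simp only [derivative_add, derivative_C, derivative_C_mul, derivative_X, zero_add, mul_one] at h2
    exact (mul_left_cancel₀ hq' h2).symm

theorem exists_eq_C_add_C_mul_of_dvd_derivative {p : ℕ} (hp : p.Prime) (f : ℤ[X])
    (hf : f.natDegree < p) (h : ∀ i, (p : ℤ) ∣ f.derivative.coeff i) :
    ∃ g : ℤ[X], f = C (f.coeff 0) + C (p : ℤ) * g ∧ g.natDegree ≤ f.natDegree ∧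
      f.derivative = C (p : ℤ) * g.derivative := by
  have hp0 : (p : ℤ) ≠ 0 := by exact_mod_cast hp.ne_zero
  have h1 : C (p : ℤ) ∣ f - C (f.coeff 0) := by
    rw [C_dvd_iff_dvd_coeff]
    rintro (- | i)
    · simp
    · rw [coeff_sub, coeff_C_succ, sub_zero]
      rcases lt_or_ge i (p - 1) with hi | hi
      · have h2 := h i
        rw [coeff_derivative] at h2
        refine (Int.Prime.dvd_mul' hp h2).resolve_right fun h3 => ?_
        have := Int.le_of_dvd (by positivity) h3
        omega
      · rw [coeff_eq_zero_of_natDegree_lt (by omega)]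
        exact dvd_zero _
  obtain ⟨g, hg⟩ := h1
  have h2 : f = C (f.coeff 0) + C (p : ℤ) * g := by rw [← hg]; ring
  refine ⟨g, h2, ?_, ?_⟩
  · rw [← natDegree_C_mul hp0, ← hg, natDegree_sub_C]
  · conv_lhs => rw [h2]
    simp

theorem map_comp_eq_C_mul_prod {K ι : Type*} [Field K] (P : ℤ[X]) (A : K)
    (s : Finset ι) (r : ι → K) (e : ι → ℕ)
    (hP : P.map (Int.castRingHom K) = C A * ∏ i ∈ s, (X - C (r i)) ^ e i) (c q : ℤ)
    (hq : (q : K) ≠ 0) :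
    (P.comp (C c + C q * X)).map (Int.castRingHom K) =
      C (A * ∏ i ∈ s, (q : K) ^ e i) * ∏ i ∈ s, (X - C ((r i - c) / q)) ^ e i := by
  rw [Polynomial.map_comp, hP, mul_comp, C_comp, prod_comp, map_mul, map_prod, mul_assoc,
    ← Finset.prod_mul_distrib]
  congr 1
  refine Finset.prod_congr rfl fun i _ => ?_
  rw [pow_comp, C_pow, ← mul_pow]
  congr 1
  simp only [sub_comp, X_comp, C_comp, Polynomial.map_add, Polynomial.map_mul, map_C, map_X,
    mul_sub, ← C_mul, mul_div_cancel₀ _ hq, C_sub]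
  simp only [eq_intCast, map_intCast]
  ring

theorem scaled_mul_prod_erase {K ι : Type*} [Field K] [DecidableEq ι] (A c q : K) (hq : q ≠ 0)
    (s : Finset ι) (r : ι → K) (e : ι → ℕ) {i : ι} (hi : i ∈ s) :
    (A * ∏ j ∈ s, q ^ e j) * ∏ j ∈ s.erase i, ((r i - c) / q - (r j - c) / q) ^ e j =
      q ^ e i * (A * ∏ j ∈ s.erase i, (r i - r j) ^ e j) := by
  rw [← Finset.mul_prod_erase s _ hi, mul_assoc A, mul_assoc (q ^ e i), ← Finset.prod_mul_distrib,
    mul_left_comm A]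
  congr 2
  refine Finset.prod_congr rfl fun j _ => ?_
  rw [← mul_pow]
  congr 1
  field_simp
  ring

theorem sum_range_sum_filter_le {K ι : Type*} [Field K] {v : AbsoluteValue K ℝ}
    (hna : IsNonarchimedean v) {p : ℕ} (hp : 1 < p) (hint : ∀ n : ℤ, v n ≤ 1)
    (hdvd : ∀ n : ℤ, v n < 1 → (p : ℤ) ∣ n) (s : Finset ι) (r : ι → K) (e : ι → ℕ) :
    ∑ c ∈ Finset.range p, ∑ i ∈ s with v (r i - c) < 1, e i ≤ ∑ i ∈ s with v (r i) < p, e i := by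
  classical
  simp only [Finset.sum_filter]
  rw [Finset.sum_comm]
  refine Finset.sum_le_sum fun i _ => ?_
  rw [← Finset.sum_filter, Finset.sum_const, smul_eq_mul]
  have hcard : ((Finset.range p).filter fun c : ℕ => v (r i - c) < 1).card ≤ 1 := by
    refine Finset.card_le_one.2 fun a ha b hb => ?_
    rw [Finset.mem_filter, Finset.mem_range] at ha hb
    have h1 : v ((a - b : ℤ) : K) < 1 := by
      have h2 := map_sub_le_max_of_isNonarchimedean hna (r i - b) (r i - a)
      rw [show r i - (b : K) - (r i - a) = ((a - b : ℤ) : K) by push_cast; ring] at h2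
      exact h2.trans_lt (max_lt hb.2 ha.2)
    have h2 := Int.eq_zero_of_abs_lt_dvd (hdvd _ h1) (by rw [abs_lt]; omega)
    omega
  split_ifs with h
  · exact mul_le_of_le_one_left (Nat.zero_le _) hcard
  · rw [Finset.card_eq_zero.2 (Finset.filter_eq_empty_iff.2 fun c _ hc => h ?_), zero_mul]
    have h1 := hna (r i - c) c
    rw [sub_add_cancel] at h1
    have h2 : v (c : K) ≤ 1 := by exact_mod_cast hint c
    exact (h1.trans (max_le hc.le h2)).trans_lt (by exact_mod_cast hp)

theorem exists_le_pow_of_factorization {K ι : Type*} [Field K]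
    [DecidableEq ι] {v : AbsoluteValue K ℝ} (hna : IsNonarchimedean v) (hint : ∀ n : ℤ, v n ≤ 1)
    (s : Finset ι) (hs : s.Nonempty) (e : ι → ℕ) (f : ℤ[X]) (A : K) (r : ι → K)
    (hfac : f.derivative.map (Int.castRingHom K) = C A * ∏ i ∈ s, (X - C (r i)) ^ e i)
    {M q : ℝ} (hM : 0 ≤ M)
    (hle : ∀ i ∈ s, q ≤ M ^ (e i + 1) * v (A * ∏ j ∈ s.erase i, (r i - r j) ^ e j)) :
    ∃ i ∈ s, q ≤ M ^ (e i + 1) := by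
  obtain ⟨i, hi, hvi⟩ := exists_map_mul_prod_erase_le hna A s hs r e
  rw [← gaussNorm_C_mul_prod hna, ← hfac] at hvi
  exact ⟨i, hi, (hle i hi).trans (mul_le_of_le_one_right (by positivity)
    (hvi.trans (gaussNorm_map_intCast_le_one hint _)))⟩

/-- The induction on the exponent of the modulus: the roots `r i` of `f'` lying within distance `p`
of the origin control the exponential sum. -/
theorem norm_expSum_le_of_factorization {p : ℕ} [hp : Fact p.Prime] {K ι : Type*} [Field K]
    [DecidableEq ι] {v : AbsoluteValue K ℝ} (hna : IsNonarchimedean v) (hint : ∀ n : ℤ, v n ≤ 1)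
    (hvp : v (p : K) = (p : ℝ)⁻¹) (hdvd : ∀ n : ℤ, v n < 1 → (p : ℤ) ∣ n)
    (s : Finset ι) (hs : s.Nonempty) (e : ι → ℕ) (he : ∀ i ∈ s, 1 ≤ e i) (d : ℕ) (hd : 1 ≤ d)
    (hdp : d < p) (m : ℕ) (f : ℤ[X]) (hf : f.natDegree ≤ d) (A : K) (r : ι → K)
    (hfac : f.derivative.map (Int.castRingHom K) = C A * ∏ i ∈ s, (X - C (r i)) ^ e i)
    (M : ℝ) (hM : 0 < M)
    (hle : ∀ i ∈ s, ((p : ℝ) ^ m)⁻¹ ≤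
      M ^ (e i + 1) * v (A * ∏ j ∈ s.erase i, (r i - r j) ^ e j)) :
    ‖expSum p m f‖ ≤ max (∑ i ∈ s with v (r i) < p, e i) 1 * (d * M) := by
  have hp0 : (0 : ℝ) < p := by exact_mod_cast hp.out.pos
  have hpz : (p : ℤ) ≠ 0 := by exact_mod_cast hp.out.ne_zero
  have hpK : (p : K) ≠ 0 := fun h => by
    rw [h, map_zero] at hvp
    exact (inv_pos.2 hp0).ne hvp
  have hd1 : (1 : ℝ) ≤ d := by exact_mod_cast hd
  have hone : ∀ (n : ℕ) (M x : ℝ), 0 < M → x ≤ d * M → x ≤ (max n 1 : ℕ) * (d * M) :=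
    fun n M x hM hx => hx.trans (le_mul_of_one_le_left (by positivity)
      (by exact_mod_cast le_max_right n 1))
  induction m generalizing f A r M with
  | zero =>
    obtain ⟨i₀, hi₀, hi₀le⟩ := exists_le_pow_of_factorization hna hint s hs e f A r hfac hM.le hle
    have hM1 : 1 ≤ M := by
      rw [pow_zero, inv_one] at hi₀le
      by_contra! h
      exact (pow_lt_one₀ hM.le h (by omega)).not_ge hi₀le
    exact hone _ _ _ hM ((norm_expSum_le_one p 0 f).trans (by nlinarith))
  | succ m ih =>
    obtain ⟨i₀, hi₀, hi₀le⟩ := exists_le_pow_of_factorization hna hint s hs e f A r hfac hM.le hle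
    by_cases hder : ∀ i, (p : ℤ) ∣ f.derivative.coeff i
    · obtain ⟨g, hg, hgd, hgder⟩ :=
        exists_eq_C_add_C_mul_of_dvd_derivative hp.out f (by omega) hder
      rw [hg, norm_expSum_C_add_C_mul]
      refine ih g (hgd.trans hf) (A / p) r ?_ M hM fun i hi => ?_
      · have hCp : C (p : K) ≠ 0 := C_ne_zero.2 hpK
        refine mul_left_cancel₀ hCp ?_
        rw [← mul_assoc, ← C_mul, mul_div_cancel₀ _ hpK, ← hfac, hgder]
        simp
      · have h1 := hle i hi
        rw [div_mul_eq_mul_div, map_div₀, hvp, div_inv_eq_mul, ← mul_assoc]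
        calc ((p : ℝ) ^ m)⁻¹ = ((p : ℝ) ^ (m + 1))⁻¹ * p := by
              rw [pow_succ]
              field_simp
          _ ≤ _ := by gcongr
    · rcases m with - | m
      · have hM1 : (√(p : ℝ))⁻¹ ≤ M := by
          have hsq : 0 < √(p : ℝ) := Real.sqrt_pos.2 hp0
          rw [zero_add, pow_one] at hi₀le
          rcases le_or_gt 1 M with h1 | h1
          · refine le_trans (inv_le_one_of_one_le₀ ?_) h1
            rw [Real.one_le_sqrt]
            exact_mod_cast hp.out.one_lt.le
          · refine le_of_sq_le_sq ?_ hM.le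
            rw [inv_pow, Real.sq_sqrt hp0.le]
            exact hi₀le.trans (pow_le_pow_of_le_one hM.le h1.le (by have := he i₀ hi₀; omega))
        refine hone _ _ _ hM ((norm_expSum_one_le f (by omega) hder).trans ?_)
        gcongr
      · have hgauss1 : v A * ∏ i ∈ s, max 1 (v (r i)) ^ e i = 1 := by
          rw [← gaussNorm_C_mul_prod hna, ← hfac]
          refine le_antisymm (gaussNorm_map_intCast_le_one hint _) ?_
          push Not at hder
          obtain ⟨i, hi⟩ := hder
          refine le_trans ?_ (le_gaussNorm v _ zero_le_one i)
          rw [one_pow, mul_one, coeff_map, eq_intCast]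
          by_contra! h1
          exact hi (hdvd _ h1)
        have hterm : ∀ c ∈ Finset.range p,
            ‖expSum p (m + 1 + 1) (f.comp (C (c : ℤ) + C (p : ℤ) * X))‖ ≤
              (∑ i ∈ s with v (r i - (c : K)) < 1, e i : ℕ) * (d * (p * M)) := fun c _ => by
          by_cases hc : (p : ℤ) ∣ f.derivative.eval (c : ℤ)
          · obtain ⟨h, hh, hhd, hhder⟩ := exists_comp_eq_C_add_C_mul f c hpz
            rw [hh, norm_expSum_C_add_C_mul]
            have hfilter : ∀ i, v ((r i - ((c : ℤ) : K)) / ((p : ℤ) : K)) < p ↔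
                v (r i - (c : K)) < 1 := fun i => by
              rw [map_div₀, Int.cast_natCast, Int.cast_natCast, hvp, div_inv_eq_mul,
                mul_lt_iff_lt_one_left hp0]
            have hex : 1 ≤ ∑ i ∈ s with v (r i - (c : K)) < 1, e i := by
              obtain ⟨i, hi, hic⟩ := exists_map_sub_lt_one hna A (c : K)
                (by exact_mod_cast hint c) s r e (by
                  rw [hgauss1]
                  have h1 := congrArg (eval (c : K)) hfac
                  rw [← Int.cast_natCast (R := K), eval_intCast_map] at h1
                  simp only [eval_mul, eval_C, eval_prod, eval_pow, eval_sub, eval_X] at h1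
                  rw [← Int.cast_natCast (R := K), ← h1]
                  obtain ⟨k, hk⟩ := hc
                  rw [Int.cast_id, hk]
                  simp only [eq_intCast, Int.cast_natCast, map_mul, hvp]
                  refine mul_lt_one_of_nonneg_of_lt_one_left (by positivity)
                    (inv_lt_one_of_one_lt₀ (by exact_mod_cast hp.out.one_lt)) (hint k))
              exact (he i hi).trans (Finset.single_le_sum (f := e) (fun _ _ => Nat.zero_le _)
                (Finset.mem_filter.2 ⟨hi, hic⟩))
            have h2 := ih h (hhd.trans hf) (A * ∏ i ∈ s, ((p : ℤ) : K) ^ e i)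
              (fun i => (r i - ((c : ℤ) : K)) / ((p : ℤ) : K))
              (by rw [hhder]; exact map_comp_eq_C_mul_prod _ A s r e hfac c p (by exact_mod_cast hpK))
              (p * M) (by positivity) fun i hi => by
                rw [scaled_mul_prod_erase A _ _ (by exact_mod_cast hpK) s r e hi, map_mul, map_pow,
                  Int.cast_natCast, hvp]
                have h3 := hle i hi
                calc ((p : ℝ) ^ (m + 1))⁻¹ = p * ((p : ℝ) ^ (m + 1 + 1))⁻¹ := by
                      rw [pow_succ _ (m + 1)]
                      field_simp
                  _ ≤ p * (M ^ (e i + 1) * v (A * ∏ j ∈ s.erase i, (r i - r j) ^ e j)) := by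
                      gcongr
                  _ = _ := by
                      rw [mul_pow, pow_succ (p : ℝ), inv_pow]
                      field_simp
            simp only [hfilter] at h2
            rwa [max_eq_left (by exact_mod_cast hex)] at h2
          · rw [expSum_comp_eq_zero m f c hc, norm_zero]
            positivity
        rw [expSum_eq_sum_comp, norm_mul, norm_inv, Complex.norm_natCast]
        have hcount := sum_range_sum_filter_le hna hp.out.one_lt hint hdvd s r e
        calc (p : ℝ)⁻¹ * _ ≤ (p : ℝ)⁻¹ * ∑ c ∈ Finset.range p,
              ((∑ i ∈ s with v (r i - (c : K)) < 1, e i : ℕ) * (d * (p * M)) : ℝ) := by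
              gcongr
              exact norm_sum_le_of_le _ hterm
          _ = (∑ c ∈ Finset.range p, ∑ i ∈ s with v (r i - (c : K)) < 1, e i : ℕ) * (d * M) := by
              rw [← Finset.sum_mul]
              push_cast
              field_simp
          _ ≤ _ := by
              gcongr
              exact_mod_cast hcount.trans (le_max_left _ 1)

/-- The Loxton–Vaughan bound: for `d ≥ 2` there is `C_d > 0` such that for each prime `p > d`,
each `f ∈ ℤ[X]` of degree `d` and each `m ≥ 1`, if `f'` factors completely over a
nonarchimedean valued field `K ⊇ ℚ_p` as `f' = a ∏_{ξ∈R} (X-ξ)^{e_ξ}`, then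
`|S_m(f)| ≤ C_d · max_{ξ∈R} (p^{-m}/|a ∏_{η≠ξ} (ξ-η)^{e_η}|)^{1/(e_ξ+1)}`, formulated as:
there is a root `ξ ∈ R` for which the bound holds. -/
theorem loxton_vaughan_bound (d : ℕ) (hd : 2 ≤ d) :
    ∃ C : ℝ, 0 < C ∧
      ∀ (p : ℕ) [Fact p.Prime], d < p →
        ∀ (K : Type) [Field K] [Algebra ℚ_[p] K] [DecidableEq K] (v : AbsoluteValue K ℝ),
          (∀ x y : K, v (x + y) ≤ max (v x) (v y)) →
          (∀ x : ℚ_[p], v (algebraMap ℚ_[p] K x) = ‖x‖) →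
          ∀ (f : Polynomial ℤ), f.natDegree = d →
            ∀ m : ℕ, 1 ≤ m →
              ∀ (R : Finset K) (e : K → ℕ) (a : K),
                (∀ ξ ∈ R, 1 ≤ e ξ) →
                a = ((derivative f).leadingCoeff : K) →
                (derivative f).map (Int.castRingHom K) =
                  Polynomial.C a * ∏ ξ ∈ R, (Polynomial.X - Polynomial.C ξ) ^ e ξ →
                ∃ ξ ∈ R,
                  ‖expSum p m f‖ ≤
                    C * (((p : ℝ) ^ m)⁻¹ / v (a * ∏ η ∈ R.erase ξ, (ξ - η) ^ e η)) ^
                      ((1 : ℝ) / ((e ξ : ℝ) + 1)) := by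
  refine ⟨d * d, by positivity, ?_⟩
  intro p hp hdp K _ _ _ v hna hv f hfd m _ R e a he ha hfac
  have hvint : ∀ n : ℤ, v (n : K) = ‖(n : ℚ_[p])‖ := fun n => by
    rw [← map_intCast (algebraMap ℚ_[p] K) n, hv]
  have : CharZero K := charZero_of_injective_algebraMap (algebraMap ℚ_[p] K).injective
  have hdeg : f.derivative.natDegree = d - 1 := by rw [natDegree_derivative, hfd]
  have ha0 : a ≠ 0 := by
    rw [ha, Int.cast_ne_zero, leadingCoeff_ne_zero]
    intro h
    rw [h, natDegree_zero] at hdeg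
    omega
  have hsum : ∑ ξ ∈ R, e ξ = d - 1 := by
    rw [← hdeg, ← natDegree_map_eq_of_injective (Int.castRingHom K).injective_int, hfac,
      natDegree_C_mul ha0, natDegree_prod_of_monic _ _ fun ξ _ => (monic_X_sub_C ξ).pow _]
    simp
  have hR : R.Nonempty := by
    by_contra h
    rw [Finset.not_nonempty_iff_eq_empty.1 h, Finset.sum_empty] at hsum
    omega
  have hB : ∀ ξ, 0 < v (a * ∏ η ∈ R.erase ξ, (ξ - η) ^ e η) := fun ξ =>
    v.pos (mul_ne_zero ha0 (Finset.prod_ne_zero_iff.2 fun η hη =>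
      pow_ne_zero _ (sub_ne_zero.2 (Finset.ne_of_mem_erase hη).symm)))
  have hp0 : (0 : ℝ) < p := by exact_mod_cast hp.out.pos
  set ρ : K → ℝ := fun ξ => (((p : ℝ) ^ m)⁻¹ / v (a * ∏ η ∈ R.erase ξ, (ξ - η) ^ e η)) ^
    ((1 : ℝ) / ((e ξ : ℝ) + 1)) with hρ
  have hq : ∀ ξ, 0 < ((p : ℝ) ^ m)⁻¹ / v (a * ∏ η ∈ R.erase ξ, (ξ - η) ^ e η) := fun ξ =>
    div_pos (by positivity) (hB ξ)
  obtain ⟨ξ, hξ, hmax⟩ := R.exists_max_image ρ hR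
  refine ⟨ξ, hξ, ?_⟩
  have hM : 0 < ρ ξ := Real.rpow_pos_of_pos (hq ξ) _
  refine (norm_expSum_le_of_factorization (v := v) hna
    (fun n => by rw [hvint]; exact Padic.norm_int_le_one n)
    (by rw [← Int.cast_natCast, hvint, Int.cast_natCast, Padic.norm_p])
    (fun n hn => by rwa [hvint, Padic.norm_intCast_lt_one_iff] at hn) R hR e he d (by omega) hdp m
    f hfd.le a id hfac (ρ ξ) hM fun η hη => ?_).trans ?_
  · have h1 : ρ η ^ (e η + 1) =
        ((p : ℝ) ^ m)⁻¹ / v (a * ∏ ζ ∈ R.erase η, (η - ζ) ^ e ζ) := by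
      simp only [hρ]
      rw [one_div, ← Nat.cast_succ]
      exact Real.rpow_inv_natCast_pow (hq η).le (Nat.succ_ne_zero _)
    refine (div_le_iff₀ (hB η)).1 ?_
    exact h1.symm.le.trans (pow_le_pow_left₀ (Real.rpow_nonneg (hq η).le _) (hmax η hη) _)
  · rw [mul_assoc (d : ℝ)]
    gcongr
    have h2 : ∑ i ∈ R with v (id i) < p, e i ≤ d :=
      (Finset.sum_le_sum_of_subset (Finset.filter_subset _ _)).trans (by omega)
    exact_mod_cast max_le h2 (by omega)
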